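/- arXiv:1710.03547 — 2 statements merged into one kernel-verified Lean document; each statement's English description precedes it below -/
import Mathlib

section
/- Let x and y be distinct singular moduli of the same discriminant Δ, each of degree 2 over ℚ and conjugate to each other over ℚ, and let m, n be non-zero integers such that x^m·y^n is a non-zero rational number. Then m = n. -/
/-- The Eisenstein-series quantity `g₂(τ) = 60 ∑' 1/(m+nτ)⁴` (junk value off `ℍ`). -/
noncomputable def g2 (τ : ℂ) : ℂ :=
  60 * ∑' p : ℤ × ℤ, if p = 0 then 0 else (((p.1 : ℂ) + (p.2 : ℂ) * τ) ^ 4)⁻¹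

/-- The Eisenstein-series quantity `g₃(τ) = 140 ∑' 1/(m+nτ)⁶` (junk value off `ℍ`). -/
noncomputable def g3 (τ : ℂ) : ℂ :=
  140 * ∑' p : ℤ × ℤ, if p = 0 then 0 else (((p.1 : ℂ) + (p.2 : ℂ) * τ) ^ 6)⁻¹

/-- Klein's modular `j`-invariant `j = 1728 g₂³ / (g₂³ - 27 g₃²)`. -/
noncomputable def klein (τ : ℂ) : ℂ :=
  1728 * g2 τ ^ 3 / (g2 τ ^ 3 - 27 * g3 τ ^ 2)

/-- `x` is a singular modulus of discriminant `Δ`: `x = j(τ)` where `τ` lies in the upper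
half-plane and is a root of a primitive integer quadratic `aX² + bX + c` (with `a > 0`) of
discriminant `Δ = b² - 4ac`. -/
def IsSingularModulus (x : ℂ) (Δ : ℤ) : Prop :=
  ∃ τ : ℂ, 0 < τ.im ∧
    (∃ a b c : ℤ, 0 < a ∧ Int.gcd a (Int.gcd b c) = 1 ∧
      (a : ℂ) * τ ^ 2 + (b : ℂ) * τ + (c : ℂ) = 0 ∧ Δ = b ^ 2 - 4 * a * c) ∧
    x = klein τ

section

open UpperHalfPlane ModularForm ModularFormClass MatrixGroups EisensteinSeries

/-- The full lattice sum of even weight `k ≥ 4` is `2 ζ(k)` times the normalised Eisenstein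
series. -/
lemma tsum_lattice_eq_zeta_mul_E {k : ℕ} (hk : 3 ≤ k) (z : ℍ) :
    (∑' p : ℤ × ℤ, if p = 0 then (0 : ℂ) else (((p.1 : ℂ) + (p.2 : ℂ) * (z : ℂ)) ^ k)⁻¹) =
      2 * riemannZeta k * E hk z := by
  have h1 := tsum_eisSummand_eq_riemannZeta_mul_eisensteinSeries hk z
  have h2 : E hk z = (1 / 2 : ℂ) * eisensteinSeries (N := 1) 0 k z := rfl
  rw [h2]
  trans riemannZeta k * eisensteinSeries (N := 1) 0 k z
  · rw [← h1, ← (finTwoArrowEquiv ℤ).symm.tsum_eq, ← (Equiv.prodComm ℤ ℤ).tsum_eq]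
    refine tsum_congr fun p ↦ ?_
    split_ifs with hp
    · obtain rfl : p = 0 := (Equiv.prodComm ℤ ℤ).injective hp
      have : k ≠ 0 := by omega
      simp [eisSummand, this]
    · simp [eisSummand, add_comm]
  · ring

lemma g2_eq (z : ℍ) : g2 z = 4 * Real.pi ^ 4 / 3 * E₄ z := by
  have hz : riemannZeta ((4 : ℕ) : ℂ) = Real.pi ^ 4 / 90 := by simpa using riemannZeta_four
  rw [g2, tsum_lattice_eq_zeta_mul_E (k := 4) (by norm_num), hz]
  ring

lemma bernoulli_four : bernoulli 4 = -1 / 30 := by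
  rw [bernoulli_eq_bernoulli'_of_ne_one (by norm_num), bernoulli'_four]

lemma bernoulli_six : bernoulli 6 = 1 / 42 := by
  rw [bernoulli_eq_bernoulli'_of_ne_one (by norm_num), bernoulli'_def]
  simp [Finset.sum_range_succ, bernoulli'_eq_zero_of_odd (n := 5) (by decide) (by norm_num)]
  norm_num [Nat.choose]

lemma riemannZeta_six_eq : riemannZeta ((6 : ℕ) : ℂ) = Real.pi ^ 6 / 945 := by
  have := riemannZeta_two_mul_nat (k := 3) (by norm_num)
  rw [show ((6 : ℕ) : ℂ) = 2 * ((3 : ℕ) : ℂ) by norm_num, this]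
  norm_num [bernoulli_six, Nat.factorial]
  ring

lemma g3_eq (z : ℍ) : g3 z = 8 * Real.pi ^ 6 / 27 * E₆ z := by
  rw [g3, tsum_lattice_eq_zeta_mul_E (k := 6) (by norm_num), riemannZeta_six_eq]
  ring

/-- Klein's invariant on the upper half-plane is `E₄³ / Δ`. -/
lemma klein_eq (z : ℍ) : klein z = E₄ z ^ 3 / discriminant z := by
  have hpi : (Real.pi : ℂ) ≠ 0 := by exact_mod_cast Real.pi_ne_zero
  have hD := discriminant_eq_E₄_cube_sub_E₆_sq z
  have h0 := discriminant_ne_zero z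
  have hD' : E₄ z ^ 3 - E₆ z ^ 2 ≠ 0 := by
    intro h; rw [hD, h] at h0; simp at h0
  rw [klein, g2_eq, g3_eq, hD]
  have : (4 * Real.pi ^ 4 / 3 * E₄ z) ^ 3 - 27 * (8 * Real.pi ^ 6 / 27 * E₆ z) ^ 2 =
      (64 * Real.pi ^ 12 / 27) * (E₄ z ^ 3 - E₆ z ^ 2) := by ring
  rw [this]
  field_simp
  ring

/-- If a product `d * g` of power series has coefficients in an `R`-stable additive subgroup `I`,
where `d = X + O(X²)` has coefficients in `R`, then so does `g`. -/
lemma coeff_mem_of_mul_coeff_mem (R : Subring ℂ) (I : AddSubgroup ℂ)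
    (hI : ∀ r ∈ R, ∀ x ∈ I, r * x ∈ I) (d g : PowerSeries ℂ) (hd : ∀ n, d.coeff n ∈ R)
    (h0 : d.coeff 0 = 0) (h1 : d.coeff 1 = 1) (hdg : ∀ n, (d * g).coeff n ∈ I) (n : ℕ) :
    g.coeff n ∈ I := by
  induction n using Nat.strong_induction_on with
  | _ n ih =>
    have h := hdg (n + 1)
    rw [PowerSeries.coeff_mul, Finset.Nat.sum_antidiagonal_succ, h0, zero_mul, zero_add,
      Finset.Nat.sum_antidiagonal_eq_sum_range_succ_mk, Finset.sum_range_succ'] at h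
    simp only [zero_add, h1, one_mul, Nat.sub_zero] at h
    refine (I.add_mem_cancel_left (I.sum_mem fun i hi ↦ hI _ (hd _) _ (ih _ ?_))).mp h
    have := Finset.mem_range.mp hi
    omega

/-- The coefficients of a power of a series with coefficients in a subring are in that subring. -/
lemma coeff_pow_mem (R : Subring ℂ) (d : PowerSeries ℂ) (hd : ∀ n, d.coeff n ∈ R) (k n : ℕ) :
    (d ^ k).coeff n ∈ R := by
  have h : d = PowerSeries.map R.subtype (PowerSeries.mk fun n ↦ (⟨d.coeff n, hd n⟩ : R)) := by
    ext n; simp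
  rw [h, ← map_pow, PowerSeries.coeff_map]
  exact Subtype.property _

/-- The `q`-expansion principle in weight `12k`: if the `q`-expansion of `f` has coefficients in
`I` and `j(τ) ∈ R`, then `f(τ) / Δ(τ)^k ∈ I`. -/
lemma div_discriminant_pow_mem (R : Subring ℂ) (I : AddSubgroup ℂ)
    (hI : ∀ r ∈ R, ∀ x ∈ I, r * x ∈ I)
    (hE : ∀ n, (qExpansion 1 E₄).coeff n ∈ R) (hD : ∀ n, (qExpansion 1 discriminant).coeff n ∈ R)
    (τ : ℍ) (hτ : E₄ τ ^ 3 / discriminant τ ∈ R) (k : ℕ) (w : ℤ) (hw : w = 12 * k)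
    (f : ModularForm 𝒮ℒ w) (hf : ∀ n, (qExpansion 1 f).coeff n ∈ I) :
    f τ / discriminant τ ^ k ∈ I := by
  induction k generalizing w with
  | zero =>
    obtain rfl : w = 0 := by simpa using hw
    obtain ⟨c, hc⟩ := levelOne_weight_zero_const f
    have h1 : (qExpansion 1 f).coeff 0 = c := by
      have : (f : ℍ → ℂ) = c • (1 : ℍ → ℂ) := by rw [hc]; ext; simp
      have h2 := ModularForm.qExpansion_smul one_pos one_mem_strictPeriods_SL c
        (1 : ModularForm 𝒮ℒ 0)
      rw [this]
      erw [h2]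
      simp [UpperHalfPlane.qExpansion_one]
    have := hf 0
    rw [h1] at this
    simpa [hc] using this
  | succ k ih =>
    set c := (qExpansion 1 f).coeff 0 with hc
    set e : ModularForm 𝒮ℒ w := ModularForm.mcast (by rw [hw]; push_cast; ring) (E₄.pow (3 * (k + 1)))
      with he
    have hce : ∀ n, (qExpansion 1 e).coeff n ∈ R := by
      rw [he, ModularForm.qExpansion_mcast, ModularForm.qExpansion_pow one_pos one_mem_strictPeriods_SL]
      exact coeff_pow_mem R _ hE _
    have he0 : (qExpansion 1 e).coeff 0 = 1 := by
      rw [he, ModularForm.qExpansion_mcast, ModularForm.qExpansion_pow one_pos one_mem_strictPeriods_SL]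
      have := E_qExpansion_coeff_zero (k := 4) (by norm_num) ⟨2, rfl⟩
      rw [PowerSeries.coeff_zero_eq_constantCoeff_apply] at this ⊢
      rw [map_pow, this, one_pow]
    set f' : ModularForm 𝒮ℒ w := f - c • e with hf'
    have hq : qExpansion 1 f' = qExpansion 1 f - c • qExpansion 1 e := by
      have := ModularForm.qExpansion_sub one_pos one_mem_strictPeriods_SL f (c • e)
      have h2 := ModularForm.qExpansion_smul one_pos one_mem_strictPeriods_SL c e
      rw [← h2]
      exact this
    have hq0 : (qExpansion 1 f').coeff 0 = 0 := by
      rw [hq, map_sub, PowerSeries.coeff_smul, he0]; simp [c]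
    have hqI : ∀ n, (qExpansion 1 f').coeff n ∈ I := fun n ↦ by
      rw [hq, map_sub, PowerSeries.coeff_smul, smul_eq_mul, mul_comm]
      exact I.sub_mem (hf n) (hI _ (hce n) _ (hf 0))
    set g := CuspForm.discriminantEquiv (toCuspForm f' hq0)
    have hfg := qExpansion_eq_qExpansion_discriminant_mul f' hq0
    have hg : ∀ n, (qExpansion 1 g).coeff n ∈ I := by
      refine coeff_mem_of_mul_coeff_mem R I hI _ _ hD ?_ discriminant_qExpansion_coeff_one
        (by rw [← hfg]; exact hqI)
      simpa using CuspFormClass.qExpansion_coeff_zero CuspForm.discriminant one_pos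
        one_mem_strictPeriods_SL
    have := ih (w - 12) (by rw [hw]; push_cast; ring) g hg
    have hfτ : f τ = c * E₄ τ ^ (3 * (k + 1)) + discriminant τ * g τ := by
      have h1 : discriminant τ * g τ = f' τ := discriminant_mul_discriminantEquiv_apply _ τ
      have h2 : f' τ = f τ - c * e τ := rfl
      have h3 : e τ = E₄ τ ^ (3 * (k + 1)) := by
        rw [he, ModularForm.coe_mcast, ModularForm.coe_pow, Pi.pow_apply]
      rw [h1, h2, h3]; ring
    have h0 := discriminant_ne_zero τ
    have : f τ / discriminant τ ^ (k + 1) =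
        (E₄ τ ^ 3 / discriminant τ) ^ (k + 1) * c + g τ / discriminant τ ^ k := by
      rw [hfτ, div_pow, ← pow_mul, pow_succ (discriminant τ)]
      field_simp
    rw [this]
    exact I.add_mem (hI _ (R.pow_mem hτ _) _ (hf 0)) ‹_›

section PowerSeriesSums

variable {P Q : PowerSeries ℂ} {q v w : ℂ}

lemma hasSum_coeff_mul (hP : HasSum (fun n ↦ P.coeff n * q ^ n) v)
    (hQ : HasSum (fun n ↦ Q.coeff n * q ^ n) w) :
    HasSum (fun n ↦ (P * Q).coeff n * q ^ n) (v * w) := by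
  have h1 := summable_norm_iff.mpr hP.summable
  have h2 := summable_norm_iff.mpr hQ.summable
  have h3 := tsum_mul_tsum_eq_tsum_sum_antidiagonal_of_summable_norm h1 h2
  have h4 := (summable_norm_sum_mul_antidiagonal_of_summable_norm h1 h2).of_norm
  rw [hP.tsum_eq, hQ.tsum_eq] at h3
  rw [h3]
  refine h4.hasSum.congr_fun fun n ↦ ?_
  rw [PowerSeries.coeff_mul, Finset.sum_mul]
  refine Finset.sum_congr rfl fun x hx ↦ ?_
  rw [← Finset.HasAntidiagonal.mem_antidiagonal.mp hx]
  ring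

lemma hasSum_coeff_one : HasSum (fun n ↦ (1 : PowerSeries ℂ).coeff n * q ^ n) 1 := by
  convert hasSum_ite_eq (0 : ℕ) (1 : ℂ) using 2 with n
  rw [PowerSeries.coeff_one]
  split_ifs with h <;> simp [h]

lemma hasSum_coeff_prod {ι : Type*} (s : Finset ι) (P : ι → PowerSeries ℂ) (v : ι → ℂ)
    (h : ∀ i ∈ s, HasSum (fun n ↦ (P i).coeff n * q ^ n) (v i)) :
    HasSum (fun n ↦ (∏ i ∈ s, P i).coeff n * q ^ n) (∏ i ∈ s, v i) := by
  classical
  induction s using Finset.induction_on with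
  | empty => simpa using hasSum_coeff_one
  | insert a s ha ih =>
    rw [Finset.prod_insert ha, Finset.prod_insert ha]
    exact hasSum_coeff_mul (h a (by simp)) (ih fun i hi ↦ h i (by simp [hi]))

lemma hasSum_coeff_expand {p : ℕ} (hp : p ≠ 0) (hP : HasSum (fun n ↦ P.coeff n * (q ^ p) ^ n) v) :
    HasSum (fun n ↦ (PowerSeries.expand p hp P).coeff n * q ^ n) v := by
  rw [← Function.Injective.hasSum_iff (mul_right_injective₀ hp)]
  · convert hP using 2 with n
    simp [PowerSeries.coeff_expand_mul, pow_mul]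
  · intro n hn
    rw [PowerSeries.coeff_expand_of_not_dvd, zero_mul]
    rintro ⟨k, rfl⟩
    exact hn ⟨k, rfl⟩

lemma hasSum_coeff_rescale {a : ℂ} (hP : HasSum (fun n ↦ P.coeff n * (a * q) ^ n) v) :
    HasSum (fun n ↦ (PowerSeries.rescale a P).coeff n * q ^ n) v := by
  convert hP using 2 with n
  rw [PowerSeries.coeff_rescale, mul_pow]
  ring

end PowerSeriesSums

lemma modular_transform {k : ℤ} (G : ModularForm 𝒮ℒ k) {a b c d : ℤ} (hdet : a * d - b * c = 1)
    {z : ℂ} (hz : 0 < z.im) :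
    G (ofComplex ((a * z + b) / (c * z + d))) = (c * z + d) ^ k * G (ofComplex z) := by
  let γ : SL(2, ℤ) := ⟨!![a, b; c, d], by rw [Matrix.det_fin_two_of]; linarith⟩
  have h : G (γ • (⟨z, hz⟩ : ℍ)) = denom γ (⟨z, hz⟩ : ℍ) ^ k * G ⟨z, hz⟩ :=
    SlashInvariantForm.slash_action_eqn'' G (MonoidHom.mem_range.mpr ⟨γ, rfl⟩) ⟨z, hz⟩
  rw [ofComplex_apply_of_im_pos hz]
  have h2 : ofComplex ((a * z + b) / (c * z + d)) = γ • (⟨z, hz⟩ : ℍ) := by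
    rw [← ofComplex_apply (γ • (⟨z, hz⟩ : ℍ)), coe_specialLinearGroup_apply]
    simp [γ]
  rw [h2, h, ModularGroup.denom_apply]
  rfl

lemma modular_transform_of_eq {k : ℤ} (G : ModularForm 𝒮ℒ k) {a b c d : ℤ}
    (hdet : a * d - b * c = 1) {z w : ℂ} (hz : 0 < z.im) (hw : w = (a * z + b) / (c * z + d)) :
    G (ofComplex w) = (c * z + d) ^ k * G (ofComplex z) :=
  hw ▸ modular_transform G hdet hz

/-- The values at `τ` of the `p`-isogenous modular form `G(pτ) ∏ G((τ + b) / p)`. -/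
noncomputable def heckeNorm {k : ℤ} (G : ModularForm 𝒮ℒ k) (p : ℕ) (τ : ℂ) : ℂ :=
  G (ofComplex (p * τ)) * ∏ b ∈ Finset.range p, G (ofComplex ((τ + b) / p))

section heckeNorm

variable {k : ℤ} (G : ModularForm 𝒮ℒ k) {p : ℕ}

lemma im_mul_pos (hp : 0 < p) {τ : ℂ} (hτ : 0 < τ.im) : 0 < ((p : ℂ) * τ).im := by
  simp [hp, hτ]

lemma im_add_div_pos (hp : 0 < p) (b : ℤ) {τ : ℂ} (hτ : 0 < τ.im) : 0 < ((τ + b) / p : ℂ).im := by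
  rw [show ((τ + b) / p : ℂ) = ((τ + b) / ((p : ℝ) : ℂ) : ℂ) by simp, Complex.div_ofReal_im]
  have : (0 : ℝ) < p := by exact_mod_cast hp
  simp only [Complex.add_im, Complex.intCast_im, add_zero]
  positivity

lemma heckeNorm_add_one (hp : 0 < p) {τ : ℂ} (hτ : 0 < τ.im) :
    heckeNorm G p (τ + 1) = heckeNorm G p τ := by
  have hp0 : (p : ℂ) ≠ 0 := by exact_mod_cast hp.ne'
  unfold heckeNorm
  congr 1
  · rw [modular_transform_of_eq G (a := 1) (b := p) (c := 0) (d := 1) (by ring) (im_mul_pos hp hτ)]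
    · simp
    · push_cast; ring
  · obtain ⟨n, rfl⟩ : ∃ n, p = n + 1 := ⟨p - 1, by omega⟩
    rw [Finset.prod_range_succ, Finset.prod_range_succ']
    congr 1
    · refine Finset.prod_congr rfl fun b _ ↦ ?_
      congr 2; push_cast; ring
    · rw [modular_transform_of_eq G (a := 1) (b := 1) (c := 0) (d := 1) (by ring)
        (im_add_div_pos hp 0 hτ)]
      · simp
      · field_simp; push_cast; ring

lemma heckeNorm_inv (hp : p.Prime) {τ : ℂ} (hτ : 0 < τ.im) :
    heckeNorm G p (-τ⁻¹) = τ ^ (k * (p + 1)) * heckeNorm G p τ := by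
  have hp0 : (p : ℂ) ≠ 0 := by exact_mod_cast hp.ne_zero
  have hτ0 : τ ≠ 0 := by rintro rfl; simp at hτ
  have h1 : G (ofComplex (p * -τ⁻¹)) = (τ / p) ^ k * G (ofComplex ((τ + (0 : ℕ)) / p)) := by
    rw [modular_transform_of_eq G (a := 0) (b := -1) (c := 1) (d := 0) (by ring)
      (im_add_div_pos hp.pos 0 hτ)]
    · simp
    · push_cast; field_simp; simp [neg_div, mul_div_cancel_left₀ _ hτ0]
  have h2 : G (ofComplex ((-τ⁻¹ + (0 : ℕ)) / p)) = (p * τ) ^ k * G (ofComplex (p * τ)) := by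
    rw [modular_transform_of_eq G (a := 0) (b := -1) (c := 1) (d := 0) (by ring)
      (im_mul_pos hp.pos hτ)]
    · simp
    · push_cast; field_simp; simp
  have := Fact.mk hp
  have h3 : ∀ b b' : ℕ, (p : ℤ) ∣ b * b' + 1 → G (ofComplex ((-τ⁻¹ + b) / p)) =
      τ ^ k * G (ofComplex ((τ + b') / p)) := by
    rintro b b' ⟨e, he⟩
    have hτ' : (τ + b') ≠ 0 := by
      intro h; have := congrArg Complex.im h; simp at this; exact hτ.ne' this
    have hτ'' : (p : ℂ) * ((τ + b') / p) + (-b' : ℤ) = τ := by push_cast; field_simp; ring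
    rw [modular_transform_of_eq G (a := b) (b := -e) (c := p) (d := -b') (by linarith)
      (im_add_div_pos hp.pos b' hτ) (w := (-τ⁻¹ + b) / p)]
    · push_cast at hτ'' ⊢
      rw [hτ'']
    · push_cast at hτ'' ⊢
      rw [hτ'']
      have : (b : ℂ) * b' + 1 = p * e := by exact_mod_cast he
      field_simp
      linear_combination -this
  have h4 : ∏ b ∈ (Finset.range p).erase 0, G (ofComplex ((-τ⁻¹ + b) / p)) =
      ∏ b ∈ (Finset.range p).erase 0, (τ ^ k * G (ofComplex ((τ + b) / p))) := by
    have hlt : ∀ b ∈ (Finset.range p).erase 0, (b : ZMod p) ≠ 0 := by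
      intro b hb
      simp only [Finset.mem_erase, Finset.mem_range] at hb
      rw [Ne, ZMod.natCast_eq_zero_iff]
      exact Nat.not_dvd_of_pos_of_lt (by omega) hb.2
    have hmem : ∀ b ∈ (Finset.range p).erase 0, (-(b : ZMod p)⁻¹).val ∈ (Finset.range p).erase 0 := by
      intro b hb
      simp only [Finset.mem_erase, Finset.mem_range, ZMod.val_lt, and_true, Ne, ZMod.val_eq_zero,
        neg_eq_zero, inv_eq_zero]
      exact hlt b hb
    have hinv : ∀ b ∈ (Finset.range p).erase 0,
        (-(((-(b : ZMod p)⁻¹).val : ℕ) : ZMod p)⁻¹).val = b := by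
      intro b hb
      simp only [ZMod.natCast_val, ZMod.cast_id', id_eq, inv_neg, inv_inv, neg_neg]
      exact ZMod.val_cast_of_lt (by simpa using (Finset.mem_erase.mp hb).2)
    refine Finset.prod_nbij' (fun b ↦ (-(b : ZMod p)⁻¹).val) (fun b ↦ (-(b : ZMod p)⁻¹).val)
      hmem hmem hinv hinv fun b hb ↦ h3 _ _ ?_
    rw [← ZMod.intCast_zmod_eq_zero_iff_dvd]
    push_cast
    simp [hlt b hb]
  have h0 : 0 ∈ Finset.range p := by simp [hp.pos]
  unfold heckeNorm
  rw [← Finset.mul_prod_erase _ _ h0, ← Finset.mul_prod_erase _ _ h0, h4, h1, h2,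
    Finset.prod_mul_distrib, Finset.prod_const, Finset.card_erase_of_mem h0, Finset.card_range]
  have h5 : τ ^ (k * (p + 1)) = τ ^ k * τ ^ k * (τ ^ k) ^ (p - 1) := by
    rw [← zpow_natCast (τ ^ k), ← zpow_mul, ← zpow_add₀ hτ0, ← zpow_add₀ hτ0]
    congr 1
    push_cast [hp.one_le]
    ring
  rw [h5, div_zpow, mul_zpow]
  have : (p : ℂ) ^ k ≠ 0 := zpow_ne_zero _ hp0
  field_simp

end heckeNorm

local notation "𝕢" => Function.Periodic.qParam

lemma qParam_mul_left {p : ℕ} (hp : p ≠ 0) (τ : ℂ) : 𝕢 1 (p * τ) = 𝕢 p τ ^ (p ^ 2) := by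
  have hp0 : (p : ℂ) ≠ 0 := by exact_mod_cast hp
  rw [Function.Periodic.qParam, Function.Periodic.qParam, ← Complex.exp_nat_mul]
  congr 1
  push_cast
  field_simp

lemma qParam_one_eq_pow {p : ℕ} (hp : p ≠ 0) (τ : ℂ) : 𝕢 1 τ = 𝕢 p τ ^ p := by
  have hp0 : (p : ℂ) ≠ 0 := by exact_mod_cast hp
  rw [Function.Periodic.qParam, Function.Periodic.qParam, ← Complex.exp_nat_mul]
  congr 1
  push_cast
  field_simp

lemma qParam_add_div {p : ℕ} (hp : p ≠ 0) (b : ℕ) (τ : ℂ) :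
    𝕢 1 ((τ + b) / p) = Complex.exp (2 * Real.pi * Complex.I / p) ^ b * 𝕢 p τ := by
  have hp0 : (p : ℂ) ≠ 0 := by exact_mod_cast hp
  rw [Function.Periodic.qParam, Function.Periodic.qParam, ← Complex.exp_nat_mul, ← Complex.exp_add]
  congr 1
  push_cast
  field_simp
  ring

/-- The `𝕢 p`-expansion of `G(pτ) ∏ G((τ + b) / p)` in terms of the `q`-expansion `g` of `G`. -/
noncomputable def heckeSeries (g : PowerSeries ℂ) (p : ℕ) (hp : p ≠ 0) : PowerSeries ℂ :=
  PowerSeries.expand (p ^ 2) (pow_ne_zero 2 hp) g *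
    ∏ b ∈ Finset.range p,
      PowerSeries.rescale (Complex.exp (2 * Real.pi * Complex.I / p) ^ b) g

section

variable {k : ℤ} (G : ModularForm 𝒮ℒ k) {p : ℕ}

lemma hasSum_qExpansion_ofComplex {z : ℂ} (hz : 0 < z.im) :
    HasSum (fun n ↦ (qExpansion 1 G).coeff n * 𝕢 1 z ^ n) (G (ofComplex z)) := by
  have := ModularForm.hasSum_qExpansion (f := G) one_pos one_mem_strictPeriods_SL (ofComplex z)
  simpa [ofComplex_apply_of_im_pos hz] using this

lemma hasSum_heckeSeries (hp : p ≠ 0) (τ : ℍ) :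
    HasSum (fun n ↦ (heckeSeries (qExpansion 1 G) p hp).coeff n * 𝕢 p τ ^ n) (heckeNorm G p τ) := by
  have hp' := Nat.pos_of_ne_zero hp
  refine hasSum_coeff_mul (hasSum_coeff_expand _ ?_) (hasSum_coeff_prod _ _ _ fun b _ ↦
    hasSum_coeff_rescale ?_)
  · rw [← qParam_mul_left hp]
    exact hasSum_qExpansion_ofComplex G (im_mul_pos hp' τ.im_pos)
  · rw [← qParam_add_div hp]
    exact hasSum_qExpansion_ofComplex G (im_add_div_pos hp' b τ.im_pos)

lemma heckeNorm_slash (hp : p.Prime) (γ : SL(2, ℤ)) :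
    (fun τ : ℍ ↦ heckeNorm G p τ) ∣[k * ((p : ℤ) + 1)] γ = fun τ : ℍ ↦ heckeNorm G p τ := by
  refine SlashInvariantForm.slash_action_generators_SL2Z ?_ ?_ γ
  · ext τ
    rw [SL_slash_apply, modular_S_smul, ModularGroup.denom_S, UpperHalfPlane.coe_mk, inv_neg,
      heckeNorm_inv G hp τ.im_pos, zpow_neg]
    have := zpow_ne_zero (k * (p + 1)) τ.ne_zero
    field_simp
  · ext τ
    rw [SL_slash_apply, modular_T_smul, ModularGroup.denom_apply]
    simp [ModularGroup.T, add_comm (1 : ℂ), heckeNorm_add_one G hp.pos τ.im_pos]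

/-- The norm of `G(pτ)` from level `Γ₀(p)` to level one. -/
noncomputable def heckeNormForm (hp : p.Prime) : ModularForm 𝒮ℒ (k * (p + 1)) where
  toFun τ := heckeNorm G p τ
  slash_action_eq' A hA := by
    obtain ⟨A, rfl⟩ := hA
    exact heckeNorm_slash G hp A
  holo' := by
    rw [UpperHalfPlane.mdifferentiable_iff]
    have hG : DifferentiableOn ℂ (G ∘ ofComplex) {z | 0 < z.im} :=
      UpperHalfPlane.mdifferentiable_iff.mp G.holo'
    have h : DifferentiableOn ℂ (heckeNorm G p) {z | 0 < z.im} := by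
      refine .mul (hG.comp (g := G ∘ ofComplex) (f := fun z : ℂ ↦ (p : ℂ) * z) (by fun_prop)
        fun z hz ↦ im_mul_pos hp.pos hz) (.fun_finsetProd fun b _ ↦ ?_)
      exact hG.comp (g := G ∘ ofComplex) (f := fun z : ℂ ↦ (z + b) / p) (by fun_prop)
        fun z hz ↦ im_add_div_pos hp.pos b hz
    refine h.congr fun z hz ↦ ?_
    simp [ofComplex_apply_of_im_pos hz]
  bdd_at_cusps' hc := by
    rw [Subgroup.IsArithmetic.isCusp_iff_isCusp_SL2Z] at hc
    rw [OnePoint.isBoundedAt_iff_forall_SL2Z hc]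
    intro γ _
    rw [heckeNorm_slash G hp]
    exact isBoundedAtImInfty_of_hasSum_qExpansion (by exact_mod_cast hp.pos)
      (hasSum_heckeSeries G hp.ne_zero)

lemma coe_heckeNormForm (hp : p.Prime) (τ : ℍ) : heckeNormForm G hp τ = heckeNorm G p τ := rfl

lemma expand_qExpansion_heckeNormForm (hp : p.Prime) :
    PowerSeries.expand p hp.ne_zero (qExpansion 1 (heckeNormForm G hp)) =
      heckeSeries (qExpansion 1 G) p hp.ne_zero := by
  have hp' : (0 : ℝ) < p := by exact_mod_cast hp.pos
  have hper : (p : ℝ) ∈ (𝒮ℒ : Subgroup (GL (Fin 2) ℝ)).strictPeriods := by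
    simpa using nsmul_mem one_mem_strictPeriods_SL p
  ext n
  trans (qExpansion p (heckeNormForm G hp)).coeff n
  · refine ModularFormClass.qExpansion_coeff_unique (f := heckeNormForm G hp)
      hp' hper (fun τ ↦ hasSum_coeff_expand _ ?_) n
    rw [← qParam_one_eq_pow hp.ne_zero]
    exact ModularForm.hasSum_qExpansion (f := heckeNormForm G hp) one_pos one_mem_strictPeriods_SL τ
  · exact (ModularFormClass.qExpansion_coeff_unique (f := heckeNormForm G hp)
      hp' hper (fun τ ↦ hasSum_heckeSeries G hp.ne_zero τ) n).symm

end

lemma exists_int_qExpansion_E₄ :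
    ∃ e : PowerSeries ℤ, qExpansion 1 E₄ = PowerSeries.map (Int.castRingHom ℂ) e := by
  refine ⟨PowerSeries.mk fun n ↦ if n = 0 then 1 else 240 * (ArithmeticFunction.sigma 3 n : ℤ), ?_⟩
  ext n
  rw [E_qExpansion_coeff _ ⟨2, rfl⟩]
  split_ifs with h
  · simp [h]
  · norm_num [h, bernoulli_four]

lemma exists_int_qExpansion_E₆ :
    ∃ e : PowerSeries ℤ, qExpansion 1 E₆ = PowerSeries.map (Int.castRingHom ℂ) e := by
  refine ⟨PowerSeries.mk fun n ↦ if n = 0 then 1 else -504 * (ArithmeticFunction.sigma 5 n : ℤ), ?_⟩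
  ext n
  rw [E_qExpansion_coeff _ ⟨3, rfl⟩]
  split_ifs with h
  · simp [h]
  · norm_num [h, bernoulli_six]

/-- The discriminant as a modular form. -/
noncomputable def discriminantForm : ModularForm 𝒮ℒ 12 := CuspForm.toModularFormₗ CuspForm.discriminant

lemma coe_discriminantForm : (discriminantForm : ℍ → ℂ) = discriminant := rfl

lemma exists_int_qExpansion_discriminant :
    ∃ e : PowerSeries ℤ,
      (1728 : ℂ) • qExpansion 1 discriminant = PowerSeries.map (Int.castRingHom ℂ) e := by
  obtain ⟨a, ha⟩ := exists_int_qExpansion_E₄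
  obtain ⟨b, hb⟩ := exists_int_qExpansion_E₆
  refine ⟨a ^ 3 - b ^ 2, ?_⟩
  have h : (((1728 : ℂ) • discriminantForm : ModularForm 𝒮ℒ 12) : ℍ → ℂ) =
      (ModularForm.mcast (by norm_num) (E₄.pow 3) : ModularForm 𝒮ℒ 12) -
        (ModularForm.mcast (by norm_num) (E₆.pow 2) : ModularForm 𝒮ℒ 12) := by
    ext τ
    have h4 : E₄.pow 3 τ = E₄ τ ^ 3 := congrFun (ModularForm.coe_pow E₄ 3) τ
    have h6 : E₆.pow 2 τ = E₆ τ ^ 2 := congrFun (ModularForm.coe_pow E₆ 2) τ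
    simp [coe_discriminantForm, discriminant_eq_E₄_cube_sub_E₆_sq, ModularForm.coe_mcast, h4, h6]
    ring
  have h2 := ModularForm.qExpansion_smul one_pos one_mem_strictPeriods_SL (1728 : ℂ) discriminantForm
  rw [coe_discriminantForm] at h2
  rw [← h2, ← coe_discriminantForm]
  trans qExpansion 1 ((1728 : ℂ) • discriminantForm : ModularForm 𝒮ℒ 12)
  · rfl
  rw [h, ModularForm.qExpansion_sub one_pos one_mem_strictPeriods_SL, ModularForm.qExpansion_mcast,
    ModularForm.qExpansion_mcast, ModularForm.qExpansion_pow one_pos one_mem_strictPeriods_SL,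
    ModularForm.qExpansion_pow one_pos one_mem_strictPeriods_SL, ha, hb]
  simp

lemma expand_map_intCast {R : Type*} [CommRing R] (p : ℕ) [Fact p.Prime] [CharP R p] (hp : p ≠ 0)
    (e : PowerSeries ℤ) :
    PowerSeries.expand p hp (PowerSeries.map (Int.castRingHom R) e) =
      PowerSeries.map (Int.castRingHom R) e ^ p := by
  have h := MvPowerSeries.map_frobenius_expand p hp (R := R) (σ := Unit)
    (f := PowerSeries.map (Int.castRingHom R) e)
  refine Eq.trans ?_ h
  change _ = PowerSeries.map (frobenius R p) (PowerSeries.expand p hp _)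
  rw [← PowerSeries.map_expand, ← RingHom.comp_apply, ← PowerSeries.map_comp]
  congr 2
  exact RingHom.ext_int _ _

/-- The modular form `u Δⁿ - v E₄³ⁿ`. -/
noncomputable def pencil (u v : ℂ) (n : ℕ) : ModularForm 𝒮ℒ (12 * n) :=
  u • ModularForm.mcast (by ring) (discriminantForm.pow n) -
    v • ModularForm.mcast (by push_cast; ring) (E₄.pow (3 * n))

lemma pencil_apply (u v : ℂ) (n : ℕ) (τ : ℍ) :
    pencil u v n τ = u * discriminant τ ^ n - v * E₄ τ ^ (3 * n) := by
  have h4 : E₄.pow (3 * n) τ = E₄ τ ^ (3 * n) := congrFun (ModularForm.coe_pow E₄ _) τ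
  have hD : discriminantForm.pow n τ = discriminant τ ^ n :=
    congrFun (ModularForm.coe_pow discriminantForm _) τ
  simp [pencil, ModularForm.coe_mcast, h4, hD]

lemma qExpansion_pencil (u v : ℂ) (n : ℕ) :
    qExpansion 1 (pencil u v n) = PowerSeries.C u * qExpansion 1 discriminant ^ n -
      PowerSeries.C v * qExpansion 1 E₄ ^ (3 * n) := by
  trans qExpansion 1 ((u • ModularForm.mcast (by ring) (discriminantForm.pow n) :
    ModularForm 𝒮ℒ (12 * n)) - (v • ModularForm.mcast (by push_cast; ring) (E₄.pow (3 * n)) :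
      ModularForm 𝒮ℒ (12 * n)) : ℍ → ℂ)
  · rfl
  rw [ModularForm.qExpansion_sub one_pos one_mem_strictPeriods_SL, FunLike.coe_smul,
    FunLike.coe_smul,
    ModularForm.qExpansion_smul one_pos one_mem_strictPeriods_SL,
    ModularForm.qExpansion_smul one_pos one_mem_strictPeriods_SL, ModularForm.qExpansion_mcast,
    ModularForm.qExpansion_mcast, ModularForm.qExpansion_pow one_pos one_mem_strictPeriods_SL,
    ModularForm.qExpansion_pow one_pos one_mem_strictPeriods_SL, PowerSeries.smul_eq_C_mul,
    PowerSeries.smul_eq_C_mul, coe_discriminantForm]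

section Valuation

variable {A : ValuationSubring ℂ} {p : ℕ}

lemma inv_mem_of_not_mem_nonunits {x : ℂ} (hx : x ∉ A.nonunits) : x⁻¹ ∈ A := by
  by_contra h
  exact hx (A.mem_nonunits_iff_or.mpr (.inr h))

lemma one_not_mem_nonunits : (1 : ℂ) ∉ A.nonunits := by
  simp [ValuationSubring.mem_nonunits_iff]

lemma mul_mem_nonunits {x y : ℂ} (hx : x ∈ A) (hy : y ∈ A.nonunits) : x * y ∈ A.nonunits := by
  rw [ValuationSubring.mem_nonunits_iff] at *
  rw [map_mul]
  exact (mul_le_of_le_one_left' ((A.valuation_le_one_iff x).mpr hx)).trans_lt hy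

lemma intCast_not_mem_nonunits (hp : p.Prime) (hpA : (p : ℂ) ∈ A.nonunits) {n : ℤ}
    (hn : ¬ (p : ℤ) ∣ n) : (n : ℂ) ∉ A.nonunits := by
  intro h
  obtain ⟨a, b, hab⟩ := (Nat.prime_iff_prime_int.mp hp).coprime_iff_not_dvd.mpr hn
  refine one_not_mem_nonunits (A := A) ?_
  rw [show (1 : ℂ) = a * (p : ℂ) + b * (n : ℂ) by exact_mod_cast hab.symm]
  exact add_mem (mul_mem_nonunits (intCast_mem A a) hpA) (mul_mem_nonunits (intCast_mem A b) h)

lemma root_of_unity_mem {ζ : ℂ} (hp : p ≠ 0) (h : ζ ^ p = 1) : ζ ∈ A := by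
  rcases A.mem_or_inv_mem ζ with h' | h'
  · exact h'
  · obtain ⟨n, rfl⟩ := Nat.exists_eq_succ_of_ne_zero hp
    have hz : ζ ≠ 0 := by rintro rfl; simp at h
    have : ζ = ζ⁻¹ ^ n := by
      rw [pow_succ] at h
      rw [inv_pow]
      exact eq_inv_of_mul_eq_one_right h
    rw [this]
    exact pow_mem h' n

lemma residue_eq_zero_iff_mem_nonunits (x : A) :
    IsLocalRing.residue A x = 0 ↔ (x : ℂ) ∈ A.nonunits := by
  rw [IsLocalRing.residue_eq_zero_iff, ValuationSubring.coe_mem_nonunits_iff]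

lemma charP_residueField (hp : p.Prime) (hpA : (p : ℂ) ∈ A.nonunits) :
    CharP (IsLocalRing.ResidueField A) p := by
  refine (CharP.charP_iff_prime_eq_zero hp).mpr ?_
  have := (residue_eq_zero_iff_mem_nonunits (p : A)).mpr (by simpa using hpA)
  simpa using this

end Valuation

section

variable {A : ValuationSubring ℂ} {p : ℕ}

lemma map_rescale {R S : Type*} [CommRing R] [CommRing S] (f : R →+* S) (a : R)
    (g : PowerSeries R) :
    PowerSeries.map f (PowerSeries.rescale a g) =
      PowerSeries.rescale (f a) (PowerSeries.map f g) := by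
  ext n
  simp [PowerSeries.coeff_rescale]

/-- In characteristic `p`, if `d`, `e` are fixed by Frobenius and `g = u d - v e`, then
`g(X^{p²}) g(X)^p` is obtained from `(u d^p - v e^p) (u^p d - v^p e)` by `X ↦ X^p`. -/
lemma expand_pencil {k : Type*} [Field k] [Fact p.Prime] [CharP k p] (hp : p ≠ 0)
    (d e : PowerSeries k) (hd : PowerSeries.expand p hp d = d ^ p)
    (he : PowerSeries.expand p hp e = e ^ p) (u v : k) :
    PowerSeries.expand (p ^ 2) (pow_ne_zero 2 hp) (PowerSeries.C u * d - PowerSeries.C v * e) *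
      (PowerSeries.C u * d - PowerSeries.C v * e) ^ p =
    PowerSeries.expand p hp ((PowerSeries.C u * d ^ p - PowerSeries.C v * e ^ p) *
      (PowerSeries.C (u ^ p) * d - PowerSeries.C (v ^ p) * e)) := by
  have : CharP (PowerSeries k) p := charP_of_injective_algebraMap
    (FaithfulSMul.algebraMap_injective k (PowerSeries k)) p
  have h2 : ∀ g : PowerSeries k, PowerSeries.expand (p ^ 2) (pow_ne_zero 2 hp) g =
      PowerSeries.expand p hp (PowerSeries.expand p hp g) := fun g ↦ by
    rw [← PowerSeries.expand_mul]; congr 2; ring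
  rw [h2, sub_pow_char]
  simp only [map_sub, map_mul, map_pow, PowerSeries.expand_C, hd, he, mul_pow]

/-- The coefficientwise congruence behind Kronecker's congruence for the modular polynomial. -/
lemma coeff_heckeNormForm_sub_mem (hp : p.Prime) (h5 : 5 ≤ p) (hpA : (p : ℂ) ∈ A.nonunits)
    {u v : ℂ} (hu : u ∈ A) (hv : v ∈ A) :
    (∀ n, (qExpansion 1 E₄).coeff n ∈ A) ∧ (∀ n, (qExpansion 1 discriminant).coeff n ∈ A) ∧
    ∀ n, (qExpansion 1 (heckeNormForm (pencil u v 1) hp)).coeff n -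
      (qExpansion 1 (pencil u v p) * qExpansion 1 (pencil (u ^ p) (v ^ p) 1)).coeff n
        ∈ A.nonunits := by
  have hp0 := hp.ne_zero
  have := Fact.mk hp
  obtain ⟨a, ha⟩ := exists_int_qExpansion_E₄
  obtain ⟨b, hb⟩ := exists_int_qExpansion_discriminant
  let ρ := IsLocalRing.residue A
  let k := IsLocalRing.ResidueField A
  have hρ : ∀ x : A, ρ x = 0 ↔ (x : ℂ) ∈ A.nonunits := residue_eq_zero_iff_mem_nonunits
  have hchar : CharP k p := charP_residueField hp hpA
  have h1728 : ((1728 : ℤ) : ℂ) ∉ A.nonunits := by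
    refine intCast_not_mem_nonunits hp hpA fun h ↦ ?_
    have h' : p ∣ 2 ^ 6 * 3 ^ 3 := by norm_num; exact_mod_cast h
    rcases (Nat.Prime.dvd_mul hp).mp h' with h | h
    · have := Nat.le_of_dvd (by norm_num) (hp.dvd_of_dvd_pow h); omega
    · have := Nat.le_of_dvd (by norm_num) (hp.dvd_of_dvd_pow h); omega
  have hc := inv_mem_of_not_mem_nonunits h1728
  set c : A := ⟨_, hc⟩ with hc_def
  have hcA : c * 1728 = 1 := by
    ext
    change ((1728 : ℤ) : ℂ)⁻¹ * 1728 = 1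
    norm_num
  set e : PowerSeries A := PowerSeries.map (Int.castRingHom A) a with he
  set d : PowerSeries A := PowerSeries.C c * PowerSeries.map (Int.castRingHom A) b with hd
  have hmapZ : ∀ f : PowerSeries ℤ, PowerSeries.map A.subtype (PowerSeries.map (Int.castRingHom A) f)
      = PowerSeries.map (Int.castRingHom ℂ) f := fun f ↦ by
    rw [← RingHom.comp_apply, ← PowerSeries.map_comp]; congr 2
  have he' : PowerSeries.map A.subtype e = qExpansion 1 E₄ := by rw [he, hmapZ, ha]
  have hd' : PowerSeries.map A.subtype d = qExpansion 1 discriminant := by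
    rw [hd, map_mul, hmapZ, ← hb, PowerSeries.map_C, PowerSeries.smul_eq_C_mul, ← mul_assoc,
      ← map_mul]
    simp [hc_def]
  refine ⟨fun n ↦ ?_, fun n ↦ ?_, fun n ↦ ?_⟩
  · rw [← he', PowerSeries.coeff_map]; exact Subtype.property _
  · rw [← hd', PowerSeries.coeff_map]; exact Subtype.property _
  have hmapk : ∀ f : PowerSeries ℤ, PowerSeries.map ρ (PowerSeries.map (Int.castRingHom A) f)
      = PowerSeries.map (Int.castRingHom k) f := fun f ↦ by
    rw [← RingHom.comp_apply, ← PowerSeries.map_comp]; congr 2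
  have hek : PowerSeries.expand p hp0 (PowerSeries.map ρ (e ^ 3)) =
      PowerSeries.map ρ (e ^ 3) ^ p := by
    rw [he, ← map_pow, hmapk, expand_map_intCast]
  have hck : ρ c ^ p = ρ c := by
    have h1 : ρ c * ((1728 : ℕ) : k) = 1 := by
      rw [← map_natCast ρ, ← map_mul]
      simpa using congrArg ρ hcA
    have h2 := congrArg (· ^ p) h1
    simp only [mul_pow, one_pow] at h2
    rw [← frobenius_def p ((1728 : ℕ) : k), map_natCast] at h2
    exact mul_right_cancel₀ (right_ne_zero_of_mul_eq_one h1) (h2.trans h1.symm)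
  have hdk : PowerSeries.expand p hp0 (PowerSeries.map ρ d) = PowerSeries.map ρ d ^ p := by
    rw [hd, map_mul, hmapk, map_mul, expand_map_intCast, PowerSeries.map_C, PowerSeries.expand_C,
      mul_pow, ← map_pow PowerSeries.C, hck]
  set U : A := ⟨u, hu⟩ with hU
  set V : A := ⟨v, hv⟩ with hV
  set g : PowerSeries A := PowerSeries.C U * d - PowerSeries.C V * e ^ 3 with hg
  set ζ : ℂ := Complex.exp (2 * Real.pi * Complex.I / p) with hζ
  have hζp : ζ ^ p = 1 := (Complex.isPrimitiveRoot_exp p hp0).pow_eq_one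
  set Z : A := ⟨ζ, root_of_unity_mem hp0 hζp⟩ with hZ
  have hZk : ρ Z = 1 := by
    have h1 : (ρ Z - 1) ^ p = 0 := by
      rw [sub_pow_char, ← map_pow, show Z ^ p = 1 by ext; simpa [hZ] using hζp]
      simp
    exact sub_eq_zero.mp (pow_eq_zero_iff hp0 |>.mp h1)
  set B : PowerSeries A := PowerSeries.expand (p ^ 2) (pow_ne_zero 2 hp0) g *
    ∏ b ∈ Finset.range p, PowerSeries.rescale (Z ^ b) g with hB
  set H : PowerSeries A := (PowerSeries.C U * d ^ p - PowerSeries.C V * (e ^ 3) ^ p) *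
      (PowerSeries.C (U ^ p) * d - PowerSeries.C (V ^ p) * e ^ 3) with hH
  have hBH : PowerSeries.map ρ B = PowerSeries.map ρ (PowerSeries.expand p hp0 H) := by
    have hgk : PowerSeries.map ρ g = PowerSeries.C (ρ U) * PowerSeries.map ρ d -
        PowerSeries.C (ρ V) * PowerSeries.map ρ (e ^ 3) := by
      rw [hg, map_sub, map_mul, map_mul _ _ (e ^ 3), PowerSeries.map_C, PowerSeries.map_C]
    have hHk : PowerSeries.map ρ H = (PowerSeries.C (ρ U) * PowerSeries.map ρ d ^ p -
        PowerSeries.C (ρ V) * PowerSeries.map ρ (e ^ 3) ^ p) *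
        (PowerSeries.C (ρ U ^ p) * PowerSeries.map ρ d -
          PowerSeries.C (ρ V ^ p) * PowerSeries.map ρ (e ^ 3)) := by
      rw [hH]
      simp only [map_sub, map_mul, map_pow, PowerSeries.map_C]
    have hBk : PowerSeries.map ρ B = PowerSeries.expand (p ^ 2) (pow_ne_zero 2 hp0)
        (PowerSeries.map ρ g) * PowerSeries.map ρ g ^ p := by
      rw [hB, map_mul, map_prod, PowerSeries.map_expand]
      simp only [map_rescale, map_pow, hZk, one_pow, PowerSeries.rescale_one, RingHom.id_apply,
        Finset.prod_const, Finset.card_range]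
    rw [PowerSeries.map_expand, hBk, hgk, hHk, expand_pencil hp0 _ _ hdk hek]
  have hgC : PowerSeries.map A.subtype g = qExpansion 1 (pencil u v 1) := by
    rw [hg, qExpansion_pencil]
    simp only [map_sub, map_mul, PowerSeries.map_C, map_pow, he', hd', pow_one, mul_one]
    rfl
  have hBC : PowerSeries.map A.subtype B = PowerSeries.expand p hp0
      (qExpansion 1 (heckeNormForm (pencil u v 1) hp)) := by
    rw [expand_qExpansion_heckeNormForm, heckeSeries, hB, ← hgC, map_mul, map_prod,
      PowerSeries.map_expand]
    simp only [map_rescale, map_pow]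
    rfl
  have hHC : PowerSeries.map A.subtype H =
      qExpansion 1 (pencil u v p) * qExpansion 1 (pencil (u ^ p) (v ^ p) 1) := by
    rw [hH, qExpansion_pencil, qExpansion_pencil]
    simp only [map_sub, map_mul, PowerSeries.map_C, map_pow, he', hd', pow_one, mul_one, pow_mul]
    rfl
  rw [← hHC, ← PowerSeries.coeff_expand_mul p hp0, ← hBC, ← PowerSeries.coeff_expand_mul p hp0 _ n,
    ← PowerSeries.map_expand, PowerSeries.coeff_map, PowerSeries.coeff_map, ← map_sub]
  change ((PowerSeries.coeff (p * n) B -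
    PowerSeries.coeff (p * n) (PowerSeries.expand p hp0 H) : A) : ℂ) ∈ A.nonunits
  rw [← hρ, map_sub, sub_eq_zero, ← PowerSeries.coeff_map, ← PowerSeries.coeff_map, hBH]

end

section

variable {A : ValuationSubring ℂ} {p : ℕ}

lemma heckeNorm_eq_zero_of_apply_eq_zero {k : ℤ} {G : ModularForm 𝒮ℒ k} {τ : ℍ}
    (h : G (ofComplex ((p : ℂ) * τ)) = 0) : heckeNorm G p τ = 0 := by
  rw [heckeNorm, h, zero_mul]

lemma sub_mul_sub_mem_nonunits (hp : p.Prime) (h5 : 5 ≤ p) (hpA : (p : ℂ) ∈ A.nonunits)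
    {u v : ℂ} (hu : u ∈ A) (hv : v ∈ A) (τ : ℍ)
    (hτ : E₄ τ ^ 3 / discriminant τ ∈ A)
    (h : pencil u v 1 (ofComplex ((p : ℂ) * τ)) = 0) :
    (u - v * (E₄ τ ^ 3 / discriminant τ) ^ p) *
      (u ^ p - v ^ p * (E₄ τ ^ 3 / discriminant τ)) ∈ A.nonunits := by
  obtain ⟨hE, hD, hH⟩ := coeff_heckeNormForm_sub_mem hp h5 hpA hu hv
  set F := heckeNormForm (pencil u v 1) hp with hF
  set H : ModularForm 𝒮ℒ (12 * (p : ℤ) + 12 * ((1 : ℕ) : ℤ)) :=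
    (pencil u v p).mul (pencil (u ^ p) (v ^ p) 1) with hHdef
  have hw : 12 * (p : ℤ) + 12 * ((1 : ℕ) : ℤ) = 12 * ((1 : ℕ) : ℤ) * (p + 1) := by
    push_cast; ring
  set f : ModularForm 𝒮ℒ (12 * ((1 : ℕ) : ℤ) * (p + 1)) := F - ModularForm.mcast hw H with hf
  have hq : ∀ n, (qExpansion 1 f).coeff n ∈ A.nonunits := fun n ↦ by
    have : qExpansion 1 f = qExpansion 1 F -
        qExpansion 1 (pencil u v p) * qExpansion 1 (pencil (u ^ p) (v ^ p) 1) := by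
      trans qExpansion 1 (F - ModularForm.mcast hw H : ℍ → ℂ)
      · rfl
      rw [ModularForm.qExpansion_sub one_pos one_mem_strictPeriods_SL,
        ModularForm.qExpansion_mcast, hHdef,
        ModularForm.qExpansion_mul one_pos one_mem_strictPeriods_SL]
    rw [this, map_sub]
    exact hH n
  have key := div_discriminant_pow_mem A.toSubring A.nonunits.toAddSubgroup
    (fun r hr x hx ↦ mul_mem_nonunits hr hx) hE hD τ hτ (p + 1) _ (by push_cast; ring) f hq
  have hval : f τ = -((u * discriminant τ ^ p - v * E₄ τ ^ (3 * p)) *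
      (u ^ p * discriminant τ ^ 1 - v ^ p * E₄ τ ^ (3 * 1))) := by
    have h1 : f τ = F τ - H τ := rfl
    have h2 : H τ = pencil u v p τ * pencil (u ^ p) (v ^ p) 1 τ := rfl
    rw [h1, h2, hF, coe_heckeNormForm, heckeNorm_eq_zero_of_apply_eq_zero h, zero_sub,
      pencil_apply, pencil_apply]
  have hne := discriminant_ne_zero τ
  have : (u - v * (E₄ τ ^ 3 / discriminant τ) ^ p) *
      (u ^ p - v ^ p * (E₄ τ ^ 3 / discriminant τ)) = -(f τ / discriminant τ ^ (p + 1)) := by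
    rw [hval, div_pow, ← pow_mul, pow_succ]
    field_simp
    ring
  rw [this]
  exact neg_mem key

/-- Kronecker's congruence: `(j(pτ) - j(τ)^p) (j(pτ)^p - j(τ))` is divisible by `p`, stated at any
place of `ℂ` above `p` where `j(τ)` is integral. -/
theorem kronecker_congruence (hp : p.Prime) (h5 : 5 ≤ p) (hpA : (p : ℂ) ∈ A.nonunits) {τ : ℂ}
    (hτ : 0 < τ.im) (hx : klein τ ∈ A) :
    klein (p * τ) ∈ A ∧
      (klein (p * τ) - klein τ ^ p) * (klein (p * τ) ^ p - klein τ) ∈ A.nonunits := by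
  have him : 0 < ((p : ℂ) * τ).im := im_mul_pos hp.pos hτ
  set z : ℍ := ⟨τ, hτ⟩ with hz
  set z' : ℍ := ofComplex ((p : ℂ) * z) with hz'
  have hcoe : (z' : ℂ) = p * τ := by
    rw [hz', ofComplex_apply_of_im_pos him]
  have hτz : klein τ = E₄ z ^ 3 / discriminant z := klein_eq z
  have hpz : klein (p * τ) = E₄ z' ^ 3 / discriminant z' := by rw [← hcoe]; exact klein_eq z'
  have hne := discriminant_ne_zero z'
  rw [hτz] at hx
  set w := klein (p * τ) with hw
  have hE : E₄ z' ^ 3 = w * discriminant z' := by rw [hpz]; field_simp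
  have hwA : w ∈ A := by
    by_contra hwA
    have hw0 : w ≠ 0 := fun h ↦ hwA (h ▸ A.zero_mem)
    have hwi : w⁻¹ ∈ A.nonunits := A.mem_nonunits_iff_or.mpr (.inr (by rwa [inv_inv]))
    have := sub_mul_sub_mem_nonunits hp h5 hpA A.one_mem (A.nonunits_subset hwi) z hx (by
      rw [← hz', pencil_apply, mul_one, hE]
      field_simp
      ring)
    have hpow : w⁻¹ ^ p ∈ A.nonunits := by
      obtain ⟨n, rfl⟩ := Nat.exists_eq_succ_of_ne_zero hp.ne_zero
      rw [pow_succ]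
      exact mul_mem_nonunits (pow_mem (A.nonunits_subset hwi) n) hwi
    set x := E₄ z ^ 3 / discriminant z with hxdef
    refine one_not_mem_nonunits (A := A) ?_
    have e : (1 : ℂ) = (1 - w⁻¹ * x ^ p) * (1 ^ p - w⁻¹ ^ p * x) + (x ^ p * w⁻¹ +
        (1 - w⁻¹ * x ^ p) * x * w⁻¹ ^ p) := by ring
    rw [e]
    refine add_mem this (add_mem (mul_mem_nonunits (pow_mem hx p) hwi) (mul_mem_nonunits ?_ hpow))
    exact mul_mem (sub_mem A.one_mem (mul_mem (A.nonunits_subset hwi) (pow_mem hx p))) hx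
  refine ⟨hwA, ?_⟩
  have := sub_mul_sub_mem_nonunits hp h5 hpA hwA A.one_mem z hx (by
      rw [← hz', pencil_apply, mul_one, hE]
      ring)
  rw [hτz]
  simpa using this

end

section

lemma exists_valuationSubring {p : ℕ} (hp : p.Prime) {v : ℂ}
    (hv : ∀ P : Polynomial ℤ, Polynomial.aeval v P = 0 → (p : ℤ) ∣ P.coeff 0) :
    ∃ A : ValuationSubring ℂ, (p : ℂ) ∈ A.nonunits ∧ v ∈ A.nonunits := by
  let R : Subring ℂ := (Polynomial.aeval v : Polynomial ℤ →ₐ[ℤ] ℂ).toRingHom.range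
  have hvR : v ∈ R := ⟨Polynomial.X, by simp⟩
  let I : Ideal R := Ideal.span {(p : R), ⟨v, hvR⟩}
  have hI : I ≠ ⊤ := by
    intro h
    obtain ⟨⟨_, f, rfl⟩, ⟨_, g, rfl⟩, hfg⟩ := Ideal.mem_span_pair.mp ((Ideal.eq_top_iff_one I).mp h)
    have h1 := congrArg (Subtype.val) hfg
    have h2 := hv (f * (p : Polynomial ℤ) + g * Polynomial.X - 1) (by
      simp only [map_sub, map_add, map_mul, map_natCast, Polynomial.aeval_X, map_one]
      rw [sub_eq_zero]
      simpa using h1)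
    simp only [Polynomial.coeff_sub, Polynomial.coeff_add, Polynomial.coeff_mul_X_zero,
      Polynomial.coeff_mul_natCast, Polynomial.coeff_one_zero, add_zero] at h2
    have h3 : (p : ℤ) ∣ 1 := by
      have := dvd_sub (dvd_mul_left (p : ℤ) (f.coeff 0)) h2
      simpa using this
    exact (Nat.prime_iff_prime_int.mp hp).not_isUnit (isUnit_of_dvd_one h3)
  obtain ⟨A, hRA, hA⟩ := Ideal.image_subset_nonunits_valuationSubring I hI
  refine ⟨A, hA ⟨(p : R), Ideal.subset_span (by simp), by simp⟩,
    hA ⟨⟨v, hvR⟩, Ideal.subset_span (by simp), rfl⟩⟩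

variable {A : ValuationSubring ℂ} {p : ℕ}

lemma exists_forall_mem_of_isAlgebraic {α : ℂ} (hα : IsAlgebraic ℚ α) :
    ∃ N : ℕ, N ≠ 0 ∧ ∀ p : ℕ, p.Prime → ¬ p ∣ N → ∀ A : ValuationSubring ℂ,
      (p : ℂ) ∈ A.nonunits → α ∈ A := by
  have hα' : IsAlgebraic ℤ α := (IsFractionRing.isAlgebraic_iff ℤ ℚ ℂ).mpr hα
  obtain ⟨d, hd, hint⟩ := hα'.exists_integral_multiple
  refine ⟨d.natAbs, by simpa using hd, fun p hp hpd A hpA ↦ ?_⟩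
  have h1 : (d : ℂ) ∉ A.nonunits := intCast_not_mem_nonunits hp hpA
    (by rwa [Int.natCast_dvd])
  have h2 : d • α ∈ A := by
    have : IsIntegral A (d • α) := hint.tower_top
    obtain ⟨y, hy⟩ := IsIntegrallyClosed.isIntegral_iff.mp this
    rw [← hy]
    exact y.2
  have hd0 : (d : ℂ) ≠ 0 := by exact_mod_cast hd
  have : α = (d : ℂ)⁻¹ * (d • α) := by
    rw [zsmul_eq_mul, inv_mul_cancel_left₀ hd0]
  rw [this]
  exact mul_mem (inv_mem_of_not_mem_nonunits h1) h2

lemma exists_forall_not_mem_nonunits {α : ℂ} (hα : IsAlgebraic ℚ α) (h0 : α ≠ 0) :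
    ∃ N : ℕ, N ≠ 0 ∧ ∀ p : ℕ, p.Prime → ¬ p ∣ N → ∀ A : ValuationSubring ℂ,
      (p : ℂ) ∈ A.nonunits → α ∉ A.nonunits := by
  obtain ⟨N, hN, h⟩ := exists_forall_mem_of_isAlgebraic hα.inv
  refine ⟨N, hN, fun p hp hpN A hpA hαA ↦ one_not_mem_nonunits (A := A) ?_⟩
  rw [← inv_mul_cancel₀ h0]
  exact mul_mem_nonunits (h p hp hpN A hpA) hαA

lemma residue_ratCast_pow (hp : p.Prime) (hpA : (p : ℂ) ∈ A.nonunits) {s : ℚ}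
    (hs : ¬ p ∣ s.den) (hsA : (s : ℂ) ∈ A) :
    IsLocalRing.residue A ⟨s, hsA⟩ ^ p = IsLocalRing.residue A ⟨s, hsA⟩ := by
  have := Fact.mk hp
  have hchar := charP_residueField hp hpA
  set r := IsLocalRing.residue A ⟨s, hsA⟩
  have h1 : r * (s.den : IsLocalRing.ResidueField A) = (s.num : IsLocalRing.ResidueField A) := by
    rw [← map_natCast (IsLocalRing.residue A), ← map_intCast (IsLocalRing.residue A), ← map_mul]
    congr 1
    ext
    change (s : ℂ) * ((s.den : A) : ℂ) = ((s.num : A) : ℂ)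
    push_cast
    exact_mod_cast Rat.mul_den_eq_num s
  have h2 := congrArg (· ^ p) h1
  simp only [mul_pow] at h2
  rw [← frobenius_def p (s.den : IsLocalRing.ResidueField A), map_natCast,
    ← frobenius_def p (s.num : IsLocalRing.ResidueField A), map_intCast] at h2
  have h3 : (s.den : IsLocalRing.ResidueField A) ≠ 0 := by
    rwa [Ne, CharP.cast_eq_zero_iff _ p]
  exact mul_right_cancel₀ h3 (h2.trans h1.symm)

/-- If `x` is a root of a rational quadratic polynomial, then so is any value congruent to a
Frobenius conjugate of `x`. -/
lemma frobenius_conj_root (hp : p.Prime) (hpA : (p : ℂ) ∈ A.nonunits) {s t : ℚ}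
    (hs : ¬ p ∣ s.den) (ht : ¬ p ∣ t.den) {x w : ℂ} (hx : x ∈ A) (hw : w ∈ A)
    (hsA : (s : ℂ) ∈ A) (htA : (t : ℂ) ∈ A) (hroot : x ^ 2 - s * x + t = 0)
    (h : (w - x ^ p) * (w ^ p - x) ∈ A.nonunits) :
    w ^ 2 - s * w + t ∈ A.nonunits := by
  have := Fact.mk hp
  have hρ : ∀ x : A, IsLocalRing.residue A x = 0 ↔ (x : ℂ) ∈ A.nonunits :=
    residue_eq_zero_iff_mem_nonunits
  have hchar := charP_residueField hp hpA
  have hsp := residue_ratCast_pow hp hpA hs hsA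
  have htp := residue_ratCast_pow hp hpA ht htA
  set S : A := ⟨s, hsA⟩
  set T : A := ⟨t, htA⟩
  lift x to A using hx
  lift w to A using hw
  set ρ := IsLocalRing.residue A
  have hx0 : ρ x ^ 2 - ρ S * ρ x + ρ T = 0 := by
    rw [← map_pow, ← map_mul, ← map_sub, ← map_add, show x ^ 2 - S * x + T = 0 by
      ext; exact hroot, map_zero]
  have hfrob : ∀ z, (z ^ 2 - ρ S * z + ρ T) ^ p = (z ^ p) ^ 2 - ρ S * z ^ p + ρ T := fun z ↦ by
    rw [add_pow_char, sub_pow_char, mul_pow, hsp, htp, ← pow_mul, ← pow_mul, mul_comm 2]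
  change ((w ^ 2 - S * w + T : A) : ℂ) ∈ A.nonunits
  change (((w - x ^ p) * (w ^ p - x) : A) : ℂ) ∈ A.nonunits at h
  rw [← hρ, map_mul, mul_eq_zero, map_sub, map_sub, sub_eq_zero, sub_eq_zero, map_pow, map_pow] at h
  rw [← hρ, map_add, map_sub, map_mul, map_pow]
  rcases h with h | h
  · rw [h, ← hfrob, hx0, zero_pow hp.ne_zero]
  · rw [← h, ← hfrob] at hx0
    exact eq_zero_of_pow_eq_zero hx0

end

lemma isAlgebraic_of_add_of_mul {x y : ℂ} {s t : ℚ} (hs : x + y = s) (ht : x * y = t) :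
    IsAlgebraic ℚ x := by
  refine ⟨Polynomial.X ^ 2 - Polynomial.C s * Polynomial.X + Polynomial.C t, ?_, ?_⟩
  · intro h
    have := congrArg (Polynomial.coeff · 2) h
    simp at this
  · simp only [map_add, map_sub, map_mul, map_pow, Polynomial.aeval_X, Polynomial.aeval_C,
      eq_ratCast, ← hs, ← ht]
    ring

lemma five_le_of_not_dvd {p : ℕ} (hp : p.Prime) (h : ¬ p ∣ 6) : 5 ≤ p := by
  by_contra! h'
  have := hp.two_le
  interval_cases p
  · exact h (by norm_num)
  · exact h (by norm_num)
  · exact absurd hp (by norm_num)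

/-- For all primes `p` outside a finite set, if `j(τ)` is one of the two conjugates `x, y` and
`j(pτ) = w`, then `w` is again one of `x, y`. -/
lemma exists_forall_klein_mul_eq {x y : ℂ} {s t : ℚ} (hs : x + y = s) (ht : x * y = t) (w : ℂ) :
    ∃ N : ℕ, N ≠ 0 ∧ ∀ p : ℕ, p.Prime → ¬ p ∣ N → ∀ τ : ℂ, 0 < τ.im →
      (klein τ = x ∨ klein τ = y) → klein (p * τ) = w → w = x ∨ w = y := by
  have hxalg := isAlgebraic_of_add_of_mul hs ht
  have hyalg := isAlgebraic_of_add_of_mul ((add_comm y x).trans hs) ((mul_comm y x).trans ht)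
  obtain ⟨Nx, hNx, hx⟩ := exists_forall_mem_of_isAlgebraic hxalg
  obtain ⟨Ny, hNy, hy⟩ := exists_forall_mem_of_isAlgebraic hyalg
  have hklein : ∀ p : ℕ, p.Prime → ¬ p ∣ Nx → ¬ p ∣ Ny → ∀ τ : ℂ,
      (klein τ = x ∨ klein τ = y) → ∀ A : ValuationSubring ℂ, (p : ℂ) ∈ A.nonunits →
      klein τ ∈ A := by
    rintro p hp hpx hpy τ (h | h) A hA
    · exact h ▸ hx p hp hpx A hA
    · exact h ▸ hy p hp hpy A hA
  by_cases hw : IsAlgebraic ℚ w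
  swap
  · refine ⟨6 * Nx * Ny, by positivity, fun p hp hpN τ hτ hτx hpτ ↦ ?_⟩
    simp only [hp.dvd_mul, not_or] at hpN
    obtain ⟨⟨h6, hpx⟩, hpy⟩ := hpN
    exfalso
    have hwi : Transcendental ℤ w⁻¹ := fun h ↦ hw <|
      (IsFractionRing.isAlgebraic_iff ℤ ℚ ℂ).mp (by simpa using h.inv)
    obtain ⟨A, hpA, hwA⟩ := exists_valuationSubring hp (v := w⁻¹) fun P hP ↦ by
      have : P = 0 := by_contra fun h ↦ hwi ⟨P, h, hP⟩
      simp [this]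
    have := (kronecker_congruence hp (five_le_of_not_dvd hp h6) hpA hτ
      (hklein p hp hpx hpy τ hτx A hpA)).1
    rw [hpτ] at this
    have hw0 : w ≠ 0 := by rintro rfl; exact hw isAlgebraic_zero
    refine one_not_mem_nonunits (A := A) ?_
    rw [← mul_inv_cancel₀ hw0]
    exact mul_mem_nonunits this hwA
  by_cases hfw : w ^ 2 - s * w + t = 0
  · refine ⟨1, one_ne_zero, fun p hp hpN τ hτ hτx hpτ ↦ ?_⟩
    have : (w - x) * (w - y) = 0 := by rw [← hfw, ← hs, ← ht]; ring
    rcases mul_eq_zero.mp this with h | h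
    · exact .inl (sub_eq_zero.mp h)
    · exact .inr (sub_eq_zero.mp h)
  have hfalg : IsAlgebraic ℚ (w ^ 2 - s * w + t) :=
    ((hw.pow 2).sub ((isAlgebraic_algebraMap s).mul hw)).add (isAlgebraic_algebraMap t)
  obtain ⟨Nf, hNf, hf⟩ := exists_forall_not_mem_nonunits hfalg hfw
  have hsalg : IsAlgebraic ℚ (s : ℂ) := isAlgebraic_algebraMap s
  have htalg : IsAlgebraic ℚ (t : ℂ) := isAlgebraic_algebraMap t
  obtain ⟨Ns, hNs, hs'⟩ := exists_forall_mem_of_isAlgebraic hsalg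
  obtain ⟨Nt, hNt, ht'⟩ := exists_forall_mem_of_isAlgebraic htalg
  refine ⟨6 * Nx * Ny * Nf * Ns * Nt * s.den * t.den, by positivity,
    fun p hp hpN τ hτ hτx hpτ ↦ ?_⟩
  simp only [hp.dvd_mul, not_or] at hpN
  obtain ⟨⟨⟨⟨⟨⟨⟨h6, hpx⟩, hpy⟩, hpf⟩, hps⟩, hpt⟩, hpsd⟩, hptd⟩ := hpN
  exfalso
  obtain ⟨A, hpA, -⟩ := exists_valuationSubring hp (v := 0) fun P hP ↦ by
    have : P.coeff 0 = 0 := by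
      rw [Polynomial.aeval_def, Polynomial.eval₂_at_zero, eq_intCast] at hP
      exact_mod_cast hP
    simp [this]
  have hτA := hklein p hp hpx hpy τ hτx A hpA
  obtain ⟨hwA, hcong⟩ := kronecker_congruence hp (five_le_of_not_dvd hp h6) hpA hτ hτA
  rw [hpτ] at hwA hcong
  refine hf p hp hpf A hpA (frobenius_conj_root hp hpA hpsd hptd hτA hwA (hs' p hp hps A hpA)
    (ht' p hp hpt A hpA) ?_ hcong)
  rw [← hs, ← ht]
  rcases hτx with h | h <;> rw [h] <;> ring

lemma exists_forall_klein_mul_mem {x y : ℂ} {s t : ℚ} (hs : x + y = s) (ht : x * y = t)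
    {S : Set ℂ} (hS : S.Finite) :
    ∃ N : ℕ, N ≠ 0 ∧ ∀ p : ℕ, p.Prime → ¬ p ∣ N → ∀ τ : ℂ, 0 < τ.im →
      (klein τ = x ∨ klein τ = y) → klein (p * τ) ∈ S →
        klein (p * τ) = x ∨ klein (p * τ) = y := by
  choose N hN h using exists_forall_klein_mul_eq hs ht
  refine ⟨∏ w ∈ hS.toFinset, N w, Finset.prod_ne_zero_iff.mpr fun w _ ↦ hN w,
    fun p hp hpN τ hτ hτx hpτ ↦ h _ p hp (fun hd ↦ hpN (hd.trans ?_)) τ hτ hτx rfl⟩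
  exact Finset.dvd_prod_of_mem N (hS.mem_toFinset.mpr hpτ)

/-- `τ` is the root in the upper half-plane of the primitive positive definite quadratic
polynomial `aX² + bX + c`. -/
structure IsFormRoot (a b c : ℤ) (τ : ℂ) : Prop where
  pos : 0 < a
  gcd_eq_one : Int.gcd a (Int.gcd b c) = 1
  im_pos : 0 < τ.im
  root : (a : ℂ) * τ ^ 2 + b * τ + c = 0

lemma isSingularModulus_iff {x : ℂ} {D : ℤ} : IsSingularModulus x D ↔
    ∃ τ a b c, IsFormRoot a b c τ ∧ D = b ^ 2 - 4 * a * c ∧ x = klein τ :=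
  ⟨fun ⟨τ, h, ⟨a, b, c, ha, hg, hr, hD⟩, hx⟩ ↦ ⟨τ, a, b, c, ⟨ha, hg, h, hr⟩, hD, hx⟩,
    fun ⟨τ, a, b, c, ⟨ha, hg, h, hr⟩, hD, hx⟩ ↦ ⟨τ, h, ⟨a, b, c, ha, hg, hr, hD⟩, hx⟩⟩

lemma gcd_gcd_eq_one_iff {a b c : ℤ} :
    Int.gcd a (Int.gcd b c) = 1 ↔ ∀ d : ℤ, d ∣ a → d ∣ b → d ∣ c → d ∣ 1 := by
  constructor
  · intro h d ha hb hc
    have := Int.dvd_coe_gcd ha (Int.dvd_coe_gcd hb hc)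
    rwa [h] at this
  · intro h
    have h1 := Int.gcd_dvd_left a (Int.gcd b c)
    have h2 := Int.gcd_dvd_right a (Int.gcd b c)
    have := h _ h1 (h2.trans (Int.gcd_dvd_left b c)) (h2.trans (Int.gcd_dvd_right b c))
    exact_mod_cast Int.eq_one_of_dvd_one (by positivity) this

lemma klein_ofComplex {τ : ℂ} (hτ : 0 < τ.im) :
    klein τ = E₄ (ofComplex τ) ^ 3 / discriminant (ofComplex τ) := by
  rw [← klein_eq, ofComplex_apply_of_im_pos hτ]

lemma denom_ne_zero_of_det {p q r s : ℤ} (hdet : p * s - q * r = 1) {τ : ℂ} (hτ : 0 < τ.im) :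
    (r : ℂ) * τ + s ≠ 0 := by
  intro h
  have him := congrArg Complex.im h
  have hre := congrArg Complex.re h
  simp at him hre
  rcases him with h' | h'
  · rw [h'] at hre
    have hs : s = 0 := by simpa using hre
    simp [h', hs] at hdet
  · exact hτ.ne' h'

lemma im_moebius_pos {p q r s : ℤ} (hdet : p * s - q * r = 1) {τ : ℂ} (hτ : 0 < τ.im) :
    0 < ((p * τ + q) / (r * τ + s) : ℂ).im := by
  have h0 := denom_ne_zero_of_det hdet hτ
  have hdet' : (p : ℝ) * s - q * r = 1 := by exact_mod_cast hdet
  have hn : 0 < Complex.normSq ((r : ℂ) * τ + s) := Complex.normSq_pos.mpr h0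
  have : ((p * τ + q) / (r * τ + s) : ℂ).im = τ.im / Complex.normSq ((r : ℂ) * τ + s) := by
    rw [Complex.div_im, ← sub_div]
    congr 1
    simp
    linear_combination τ.im * hdet'
  rw [this]
  positivity

/-- Klein's invariant is invariant under `SL(2, ℤ)`. -/
lemma klein_moebius {p q r s : ℤ} (hdet : p * s - q * r = 1) {τ : ℂ} (hτ : 0 < τ.im) :
    klein ((p * τ + q) / (r * τ + s)) = klein τ := by
  have h0 := denom_ne_zero_of_det hdet hτ
  rw [klein_ofComplex hτ, klein_ofComplex (im_moebius_pos hdet hτ), modular_transform E₄ hdet hτ,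
    ← coe_discriminantForm, modular_transform discriminantForm hdet hτ, mul_pow]
  rw [show (((r : ℂ) * τ + s) ^ (12 : ℤ)) = (((r : ℂ) * τ + s) ^ (4 : ℤ)) ^ 3 by
    rw [← zpow_natCast, ← zpow_mul]; norm_num]
  rw [mul_div_mul_left]
  positivity

namespace IsFormRoot

variable {a b c : ℤ} {τ : ℂ}

lemma two_mul_re (h : IsFormRoot a b c τ) : 2 * a * τ.re = -b := by
  have him := congrArg Complex.im h.root
  simp [pow_two] at him
  have := h.im_pos
  have : τ.im * (2 * a * τ.re + b) = 0 := by linear_combination him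
  rcases mul_eq_zero.mp this with h' | h'
  · exact absurd h' h.im_pos.ne'
  · linear_combination h'

lemma mul_normSq (h : IsFormRoot a b c τ) : a * Complex.normSq τ = c := by
  have hre := congrArg Complex.re h.root
  simp [pow_two] at hre
  rw [Complex.normSq_apply]
  linear_combination -hre + τ.re * h.two_mul_re

lemma sq_im (h : IsFormRoot a b c τ) : (2 * a * τ.im) ^ 2 = 4 * a * c - b ^ 2 := by
  have h1 := h.mul_normSq
  rw [Complex.normSq_apply] at h1
  linear_combination 4 * (a : ℝ) * h1 - (2 * a * τ.re - b) * h.two_mul_re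

lemma discr_pos (h : IsFormRoot a b c τ) : 0 < 4 * a * c - b ^ 2 := by
  have h1 := h.sq_im
  have h2 : (0 : ℝ) < a := by exact_mod_cast h.pos
  have h3 := h.im_pos
  have : (0 : ℝ) < 4 * a * c - b ^ 2 := h1 ▸ by positivity
  exact_mod_cast this

lemma moebius (h : IsFormRoot a b c τ) {p q r s : ℤ} (hdet : p * s - q * r = 1) :
    IsFormRoot (a * p ^ 2 + b * p * r + c * r ^ 2)
      (2 * a * p * q + b * (p * s + q * r) + 2 * c * r * s) (a * q ^ 2 + b * q * s + c * s ^ 2)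
      (((s : ℤ) * τ + (-q : ℤ)) / ((-r : ℤ) * τ + (p : ℤ))) where
  pos := by
    have hD := h.discr_pos
    have ha := h.pos
    have key : 4 * a * (a * p ^ 2 + b * p * r + c * r ^ 2) =
      (2 * a * p + b * r) ^ 2 + (4 * a * c - b ^ 2) * r ^ 2 := by ring
    have : 0 < (2 * a * p + b * r) ^ 2 + (4 * a * c - b ^ 2) * r ^ 2 := by
      rcases eq_or_ne r 0 with rfl | hr
      · have hp : p ≠ 0 := by rintro rfl; simp at hdet
        have : 2 * a * p + b * 0 ≠ 0 := by simp [ha.ne', hp]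
        positivity
      · positivity
    rw [← key] at this
    exact pos_of_mul_pos_right this (by positivity)
  gcd_eq_one := by
    rw [gcd_gcd_eq_one_iff]
    intro d h1 h2 h3
    refine gcd_gcd_eq_one_iff.mp h.gcd_eq_one d ?_ ?_ ?_
    · rw [show a = (a * p ^ 2 + b * p * r + c * r ^ 2) * s ^ 2 -
        (2 * a * p * q + b * (p * s + q * r) + 2 * c * r * s) * (s * r) +
        (a * q ^ 2 + b * q * s + c * s ^ 2) * r ^ 2 by
          linear_combination (-a * (p * s - q * r + 1)) * hdet]
      exact dvd_add (dvd_sub (h1.mul_right _) (h2.mul_right _)) (h3.mul_right _)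
    · rw [show b = (a * p ^ 2 + b * p * r + c * r ^ 2) * (-2 * q * s) +
        (2 * a * p * q + b * (p * s + q * r) + 2 * c * r * s) * (p * s + q * r) +
        (a * q ^ 2 + b * q * s + c * s ^ 2) * (-2 * p * r) by
          linear_combination (-b * (p * s - q * r + 1)) * hdet]
      exact dvd_add (dvd_add (h1.mul_right _) (h2.mul_right _)) (h3.mul_right _)
    · rw [show c = (a * p ^ 2 + b * p * r + c * r ^ 2) * q ^ 2 -
        (2 * a * p * q + b * (p * s + q * r) + 2 * c * r * s) * (p * q) +
        (a * q ^ 2 + b * q * s + c * s ^ 2) * p ^ 2 by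
          linear_combination (-c * (p * s - q * r + 1)) * hdet]
      exact dvd_add (dvd_sub (h1.mul_right _) (h2.mul_right _)) (h3.mul_right _)
  im_pos := im_moebius_pos (by linear_combination hdet) h.im_pos
  root := by
    have h0 := denom_ne_zero_of_det (p := s) (q := -q) (r := -r) (s := p)
      (by linear_combination hdet) h.im_pos
    have hdet' : (p : ℂ) * s - q * r = 1 := by exact_mod_cast hdet
    have hdiv : ∀ A B C n d : ℂ, d ≠ 0 →
        A * (n / d) ^ 2 + B * (n / d) + C = (A * n ^ 2 + B * n * d + C * d ^ 2) / d ^ 2 := by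
      intro A B C n d hd
      field_simp
    rw [hdiv _ _ _ _ _ h0, div_eq_zero_iff]
    left
    push_cast
    linear_combination ((p : ℂ) * s - q * r) ^ 2 * h.root

lemma discr_moebius {p q r s : ℤ} (hdet : p * s - q * r = 1) :
    (2 * a * p * q + b * (p * s + q * r) + 2 * c * r * s) ^ 2 -
      4 * (a * p ^ 2 + b * p * r + c * r ^ 2) * (a * q ^ 2 + b * q * s + c * s ^ 2) =
    b ^ 2 - 4 * a * c := by
  linear_combination ((b ^ 2 - 4 * a * c) * (p * s - q * r + 1)) * hdet

lemma klein_moebius (h : IsFormRoot a b c τ) {p q r s : ℤ} (hdet : p * s - q * r = 1) :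
    klein (((s : ℤ) * τ + (-q : ℤ)) / ((-r : ℤ) * τ + (p : ℤ))) = klein τ :=
  _root_.klein_moebius (by linear_combination hdet) h.im_pos

/-- Every form is equivalent to a reduced one. -/
lemma exists_reduced (h : IsFormRoot a b c τ) :
    ∃ a' b' c' τ', IsFormRoot a' b' c' τ' ∧ b' ^ 2 - 4 * a' * c' = b ^ 2 - 4 * a * c ∧
      klein τ' = klein τ ∧ |b'| ≤ a' ∧ a' ≤ c' := by
  obtain ⟨γ, hγ⟩ := ModularGroup.exists_smul_mem_fd (⟨τ, h.im_pos⟩ : ℍ)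
  have hdet : γ 1 1 * γ 0 0 - (-γ 0 1) * (-γ 1 0) = 1 := by
    have := γ.det_coe
    rw [Matrix.det_fin_two] at this
    linear_combination this
  refine ⟨_, _, _, _, h.moebius hdet, discr_moebius hdet, h.klein_moebius hdet, ?_⟩
  have hr := h.moebius hdet
  have hcoe : ((γ • (⟨τ, h.im_pos⟩ : ℍ) : ℍ) : ℂ) = ((γ 0 0 : ℤ) * τ + (- -γ 0 1 : ℤ)) /
      ((- -γ 1 0 : ℤ) * τ + (γ 1 1 : ℤ)) := by
    rw [coe_specialLinearGroup_apply]
    simp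
  generalize a * γ 1 1 ^ 2 + b * γ 1 1 * -γ 1 0 + c * (-γ 1 0) ^ 2 = a' at *
  generalize 2 * a * γ 1 1 * -γ 0 1 + b * (γ 1 1 * γ 0 0 + -γ 0 1 * -γ 1 0) +
    2 * c * -γ 1 0 * γ 0 0 = b' at *
  generalize a * (-γ 0 1) ^ 2 + b * -γ 0 1 * γ 0 0 + c * γ 0 0 ^ 2 = c' at *
  rw [← hcoe] at hr
  obtain ⟨h1, h2⟩ := hγ
  generalize γ • (⟨τ, h.im_pos⟩ : ℍ) = z at *
  have e1 := hr.two_mul_re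
  have e2 := hr.mul_normSq
  have ha : (0 : ℝ) < a' := by exact_mod_cast hr.pos
  constructor
  · have : |(b' : ℝ)| ≤ a' := by
      rw [← abs_neg, ← e1, abs_mul, abs_mul, abs_two, abs_of_pos ha]
      have h2' : |(z : ℂ).re| ≤ 1 / 2 := h2
      nlinarith
    exact_mod_cast this
  · have h1' : 1 ≤ Complex.normSq z := h1
    have : (a' : ℝ) ≤ c' := by rw [← e2]; nlinarith
    exact_mod_cast this

end IsFormRoot

namespace IsFormRoot

variable {a b c : ℤ} {τ : ℂ}

lemma two_mul_im (h : IsFormRoot a b c τ) : 2 * a * τ.im = √(4 * a * c - b ^ 2) := by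
  have h1 : (0 : ℝ) < a := by exact_mod_cast h.pos
  have h2 := h.im_pos
  rw [← h.sq_im, Real.sqrt_sq (by positivity)]

lemma eq_div (h : IsFormRoot a b c τ) :
    τ = (-b + √(4 * a * c - b ^ 2) * Complex.I) / (2 * a) := by
  have h1 : (a : ℂ) ≠ 0 := by exact_mod_cast h.pos.ne'
  have hre : (2 * a * τ.re : ℂ) = -b := by exact_mod_cast h.two_mul_re
  rw [← h.two_mul_im, eq_div_iff (by simpa using h1)]
  push_cast
  linear_combination -(2 * (a : ℂ)) * Complex.re_add_im τ + hre

lemma three_mul_sq_le {a b c : ℤ} (ha : 0 < a) (hb : |b| ≤ a) (hac : a ≤ c) :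
    3 * a * c ≤ 4 * a * c - b ^ 2 := by
  have : b ^ 2 ≤ a ^ 2 := sq_le_sq' (by linarith [neg_abs_le b]) (by linarith [le_abs_self b])
  nlinarith

lemma mul_left {p : ℕ} (hp : p.Prime) (h : IsFormRoot (p * a) b c τ)
    (hD : ¬ (p : ℤ) ∣ b ^ 2 - 4 * (p * a) * c) : IsFormRoot a b (p * c) (p * τ) where
  pos := pos_of_mul_pos_right h.pos (by positivity)
  gcd_eq_one := by
    rw [gcd_gcd_eq_one_iff]
    intro d h1 h2 h3
    have hpr := Nat.prime_iff_prime_int.mp hp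
    have hcop : IsCoprime d (p : ℤ) := by
      rw [isCoprime_comm, hpr.coprime_iff_not_dvd]
      intro hpd
      refine hD (dvd_sub ((hpd.trans h2).trans (dvd_pow_self b two_ne_zero)) ?_)
      exact ⟨4 * a * c, by ring⟩
    exact gcd_gcd_eq_one_iff.mp h.gcd_eq_one d (h1.mul_left _) h2 (hcop.dvd_of_dvd_mul_left h3)
  im_pos := im_mul_pos hp.pos h.im_pos
  root := by
    have := h.root
    push_cast at this ⊢
    linear_combination (p : ℂ) * this

end IsFormRoot

lemma finite_singularModuli (D : ℤ) : {x | IsSingularModulus x D}.Finite := by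
  refine ((((Set.finite_Icc (-|D|) |D|).prod (Set.finite_Icc (-|D|) |D|)).prod
    (Set.finite_Icc (-|D|) |D|)).image fun t : (ℤ × ℤ) × ℤ ↦
      klein ((-t.1.2 + √(4 * t.1.1 * t.2 - t.1.2 ^ 2) * Complex.I) / (2 * t.1.1))).subset ?_
  intro x hx
  obtain ⟨τ, a, b, c, h, rfl, rfl⟩ := isSingularModulus_iff.mp hx
  obtain ⟨a', b', c', τ', h', hD, hk, hb, hac⟩ := h.exists_reduced
  rw [← hD]
  have h1 := IsFormRoot.three_mul_sq_le h'.pos hb hac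
  have h2 := h'.pos
  have h3 := h'.discr_pos
  have h4 : |b' ^ 2 - 4 * a' * c'| = 4 * a' * c' - b' ^ 2 := by
    rw [abs_sub_comm, abs_of_pos h3]
  have h5 : c' ≤ |b' ^ 2 - 4 * a' * c'| := by rw [h4]; nlinarith
  refine ⟨((a', b'), c'), ⟨⟨⟨?_, ?_⟩, ⟨?_, ?_⟩⟩, ⟨?_, h5⟩⟩, ?_⟩
  · dsimp; linarith
  · dsimp; linarith
  · dsimp; linarith [neg_abs_le b']
  · dsimp; linarith [le_abs_self b']
  · dsimp; linarith
  · dsimp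
    rw [← h'.eq_div, hk]

lemma exists_isCoprime_form_value {a b c : ℤ} (h : Int.gcd a (Int.gcd b c) = 1) {M : ℕ}
    (hM : M ≠ 0) : ∃ p r : ℤ, IsCoprime p r ∧
      ∀ q : ℕ, q.Prime → q ∣ M → ¬ (q : ℤ) ∣ a * p ^ 2 + b * p * r + c * r ^ 2 := by
  let s := M.primeFactors.filter fun q : ℕ ↦ (q : ℤ) ∣ a ∧ ¬ (q : ℤ) ∣ c
  let t := M.primeFactors.filter fun q : ℕ ↦ ¬ (q : ℤ) ∣ a
  have hdvd : ∀ u ⊆ M.primeFactors, ∀ q : ℕ, q.Prime → ((q : ℤ) ∣ ((∏ l ∈ u, l : ℕ) : ℤ) ↔ q ∈ u) := by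
    intro u hu q hq
    rw [Int.natCast_dvd_natCast, hq.prime.dvd_finsetProd_iff]
    constructor
    · rintro ⟨l, hl, hql⟩
      rwa [(Nat.prime_dvd_prime_iff_eq hq (Nat.prime_of_mem_primeFactors (hu hl))).mp hql]
    · exact fun h ↦ ⟨q, h, dvd_rfl⟩
  have hs := hdvd s (Finset.filter_subset _ _)
  have ht := hdvd t (Finset.filter_subset _ _)
  refine ⟨(∏ l ∈ s, l : ℕ), (∏ l ∈ t, l : ℕ), ?_, fun q hq hqM ↦ ?_⟩
  · rw [Nat.isCoprime_iff_coprime]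
    refine Nat.coprime_of_dvd fun q hq h1 h2 ↦ ?_
    have h1' := (hs q hq).mp (by exact_mod_cast h1)
    have h2' := (ht q hq).mp (by exact_mod_cast h2)
    exact (Finset.mem_filter.mp h2').2 (Finset.mem_filter.mp h1').2.1
  · have hs' := hs q hq
    have ht' := ht q hq
    generalize ((∏ l ∈ s, l : ℕ) : ℤ) = p at *
    generalize ((∏ l ∈ t, l : ℕ) : ℤ) = r at *
    have hqP : q ∈ M.primeFactors := Nat.mem_primeFactors.mpr ⟨hq, hqM, hM⟩
    simp only [s, t, Finset.mem_filter, hqP, true_and] at hs' ht'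
    have hpr := Nat.prime_iff_prime_int.mp hq
    intro hval
    by_cases ha : (q : ℤ) ∣ a
    · have hr : ¬ (q : ℤ) ∣ r := by rw [ht']; exact not_not.mpr ha
      by_cases hc : (q : ℤ) ∣ c
      · have hp : ¬ (q : ℤ) ∣ p := by rw [hs']; exact fun h ↦ h.2 hc
        have hb : (q : ℤ) ∣ b * p * r := by
          have e : b * p * r = (a * p ^ 2 + b * p * r + c * r ^ 2) - a * p ^ 2 - c * r ^ 2 := by
            ring
          rw [e]
          exact dvd_sub (dvd_sub hval (ha.mul_right _)) (hc.mul_right _)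
        have hb' : (q : ℤ) ∣ b :=
          ((hpr.dvd_or_dvd hb).resolve_right hr |> hpr.dvd_or_dvd).resolve_right hp
        exact hpr.not_isUnit (isUnit_of_dvd_one (gcd_gcd_eq_one_iff.mp h q ha hb' hc))
      · have hp : (q : ℤ) ∣ p := hs'.mpr ⟨ha, hc⟩
        have : (q : ℤ) ∣ c * r ^ 2 := by
          have e : c * r ^ 2 = (a * p ^ 2 + b * p * r + c * r ^ 2) - p * (a * p + b * r) := by ring
          rw [e]
          exact dvd_sub hval (hp.mul_right _)
        exact ((hpr.dvd_or_dvd this).resolve_left hc |> hpr.dvd_of_dvd_pow) |> hr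
    · have hr : (q : ℤ) ∣ r := ht'.mpr ha
      have hp : ¬ (q : ℤ) ∣ p := by rw [hs']; exact fun h ↦ ha h.1
      have : (q : ℤ) ∣ a * p ^ 2 := by
        have e : a * p ^ 2 = (a * p ^ 2 + b * p * r + c * r ^ 2) - r * (b * p + c * r) := by ring
        rw [e]
        exact dvd_sub hval (hr.mul_right _)
      exact ((hpr.dvd_or_dvd this).resolve_left ha |> hpr.dvd_of_dvd_pow) |> hp

section Chain

variable {P : ℂ → Prop} {D : ℤ} {N : ℕ}

lemma exists_isFormRoot_one_of_coprime (hDN : D ∣ N)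
    (step : ∀ p : ℕ, p.Prime → ¬ p ∣ N → ∀ τ : ℂ, 0 < τ.im → P (klein τ) →
      IsSingularModulus (klein (p * τ)) D → P (klein (p * τ))) (a : ℕ) :
    ∀ (b c : ℤ) (τ : ℂ), IsFormRoot a b c τ → b ^ 2 - 4 * a * c = D → P (klein τ) →
      (∀ q : ℕ, q.Prime → q ∣ N → ¬ q ∣ a) →
      ∃ b c τ, IsFormRoot 1 b c τ ∧ b ^ 2 - 4 * 1 * c = D ∧ P (klein τ) := by
  induction a using Nat.strong_induction_on with
  | _ a ih =>
    intro b c τ h hD hP hq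
    rcases eq_or_ne a 1 with rfl | ha
    · exact ⟨b, c, τ, by exact_mod_cast h, by exact_mod_cast hD, hP⟩
    obtain ⟨p, hp, a', rfl⟩ := Nat.exists_prime_and_dvd ha
    have hpN : ¬ p ∣ N := fun h' ↦ hq p hp h' (dvd_mul_right p a')
    push_cast at h hD
    have h' := h.mul_left hp (fun hd ↦ hpN (by
      rw [hD] at hd
      exact_mod_cast hd.trans hDN))
    have hD' : b ^ 2 - 4 * (a' : ℤ) * (p * c) = D := by rw [← hD]; ring
    have ha' : 0 < a' := by exact_mod_cast h'.pos
    refine ih a' ?_ b (p * c) (p * τ) h' hD' (step p hp hpN τ h.im_pos hP ?_)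
      (fun q hq' hqN hqa ↦ hq q hq' hqN (hqa.mul_left p))
    · exact lt_mul_of_one_lt_left ha' hp.one_lt
    · exact isSingularModulus_iff.mpr ⟨_, _, _, _, h', hD'.symm, rfl⟩

lemma exists_isFormRoot_one (hN : N ≠ 0) (hDN : D ∣ N)
    (step : ∀ p : ℕ, p.Prime → ¬ p ∣ N → ∀ τ : ℂ, 0 < τ.im → P (klein τ) →
      IsSingularModulus (klein (p * τ)) D → P (klein (p * τ))) {a b c : ℤ} {τ : ℂ}
    (h : IsFormRoot a b c τ) (hD : b ^ 2 - 4 * a * c = D) (hP : P (klein τ)) :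
    ∃ b c τ, IsFormRoot 1 b c τ ∧ b ^ 2 - 4 * 1 * c = D ∧ P (klein τ) := by
  obtain ⟨p, r, ⟨s, q, hsq⟩, hM⟩ := exists_isCoprime_form_value h.gcd_eq_one hN
  have hdet : p * s - (-q) * r = 1 := by linear_combination hsq
  have h' := h.moebius hdet
  have hk := h.klein_moebius hdet
  have hd := (IsFormRoot.discr_moebius (a := a) (b := b) (c := c) hdet).trans hD
  obtain ⟨n, hn⟩ := Int.eq_ofNat_of_zero_le h'.pos.le
  rw [hn] at h' hd hM
  exact exists_isFormRoot_one_of_coprime hDN step n _ _ _ h' hd (by rwa [hk])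
    fun q hq hqN hqn ↦ hM q hq hqN (by exact_mod_cast hqn)

end Chain

/-- Two conjugate singular moduli of degree two include the dominant one. -/
lemma exists_dominant {x y : ℂ} {s t : ℚ} (hs : x + y = s) (ht : x * y = t) {D : ℤ}
    (hx : IsSingularModulus x D) :
    ∃ b c τ, IsFormRoot 1 b c τ ∧ b ^ 2 - 4 * 1 * c = D ∧ (klein τ = x ∨ klein τ = y) := by
  obtain ⟨N, hN, h⟩ := exists_forall_klein_mul_mem hs ht (finite_singularModuli D)
  obtain ⟨τ, a, b, c, hτ, rfl, rfl⟩ := isSingularModulus_iff.mp hx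
  have hD : b ^ 2 - 4 * a * c ≠ 0 := by have := hτ.discr_pos; linarith
  refine exists_isFormRoot_one (P := fun z ↦ z = klein τ ∨ z = y)
    (N := N * (b ^ 2 - 4 * a * c).natAbs) (by simp [hN, hD]) ?_ ?_ hτ rfl (.inl rfl)
  · push_cast
    exact (self_dvd_abs _).mul_left _
  · intro p hp hpN z hz hP hS
    exact h p hp (fun hd ↦ hpN (hd.mul_right _)) z hz hP hS

lemma add_one_pow_four_le (n : ℕ) : (n + 1) ^ 4 ≤ 16 ^ n := by
  have : n + 1 ≤ 2 ^ n := Nat.lt_two_pow_self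
  calc (n + 1) ^ 4 ≤ (2 ^ n) ^ 4 := Nat.pow_le_pow_left this 4
    _ = 16 ^ n := by rw [← pow_mul, mul_comm, pow_mul]; norm_num

lemma norm_E₄_sub_one_le {τ : ℍ} (h : ‖𝕢 1 τ‖ ≤ 1 / 140) :
    ‖E₄ τ - 1‖ ≤ 271 * ‖𝕢 1 τ‖ := by
  set q := 𝕢 1 τ with hq
  have h1 := ModularForm.hasSum_qExpansion (f := E₄) one_pos one_mem_strictPeriods_SL τ
  have h2 := (hasSum_nat_add_iff' 1).mpr h1
  simp only [Finset.sum_range_one, pow_zero, E_qExpansion_coeff_zero _ ⟨2, rfl⟩, mul_one] at h2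
  have hr : |16 * ‖q‖| < 1 := by
    rw [abs_of_nonneg (by positivity)]; linarith
  have h3 := (hasSum_geometric_of_abs_lt_one hr).mul_left (240 * ‖q‖)
  have h4 : ‖E₄ τ - 1‖ ≤ 240 * ‖q‖ * (1 - 16 * ‖q‖)⁻¹ := by
    rw [← h2.tsum_eq]
    refine tsum_of_norm_bounded h3 fun n ↦ ?_
    have hc : (qExpansion 1 E₄).coeff (n + 1) = 240 * (ArithmeticFunction.sigma 3 (n + 1) : ℂ) := by
      rw [E_qExpansion_coeff _ ⟨2, rfl⟩]
      norm_num [bernoulli_four]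
    have hσ : (ArithmeticFunction.sigma 3 (n + 1) : ℝ) ≤ 16 ^ n := by
      exact_mod_cast (ArithmeticFunction.sigma_le_pow_succ 3 (n + 1)).trans (add_one_pow_four_le n)
    rw [hc, norm_mul, norm_mul, norm_pow, Complex.norm_natCast, Complex.norm_ofNat, ← hq]
    calc 240 * (ArithmeticFunction.sigma 3 (n + 1) : ℝ) * ‖q‖ ^ (n + 1)
        ≤ 240 * 16 ^ n * ‖q‖ ^ (n + 1) := by gcongr
      _ = 240 * ‖q‖ * (16 * ‖q‖) ^ n := by rw [mul_pow]; ring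
  refine h4.trans ?_
  rw [← div_eq_mul_inv, div_le_iff₀ (by linarith)]
  nlinarith [norm_nonneg q]

lemma norm_discriminant_sub_le {τ : ℍ} (h : ‖𝕢 1 τ‖ ≤ 1 / 140) :
    ∃ P : ℂ, ‖P - 1‖ ≤ 1 / 138 ∧ discriminant τ = 𝕢 1 τ * P ^ 24 := by
  set q := 𝕢 1 τ with hq
  have hq1 : ‖q‖ < 1 := by linarith
  have hm := multipliable_one_sub_pow hq1
  refine ⟨∏' n : ℕ, (1 - q ^ (n + 1)), ?_, ?_⟩
  swap
  · rw [discriminant_eq_q_prod, ← hm.tprod_pow]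
  have ht := (hm.hasProd.tendsto_prod_nat.sub_const 1).norm
  refine le_of_tendsto' ht fun N ↦ ?_
  have h1 := (Finset.range N).norm_prod_one_add_sub_one_le (fun n ↦ -q ^ (n + 1))
  simp only [← sub_eq_add_neg, norm_neg, norm_pow] at h1
  have h2 : ∑ n ∈ Finset.range N, ‖q‖ ^ (n + 1) ≤ 1 / 139 := by
    have hs : HasSum (fun n ↦ ‖q‖ * ‖q‖ ^ n) (‖q‖ * (1 - ‖q‖)⁻¹) :=
      (hasSum_geometric_of_lt_one (norm_nonneg q) hq1).mul_left _
    calc ∑ n ∈ Finset.range N, ‖q‖ ^ (n + 1) = ∑ n ∈ Finset.range N, ‖q‖ * ‖q‖ ^ n := by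
          simp only [pow_succ']
      _ ≤ ‖q‖ * (1 - ‖q‖)⁻¹ := sum_le_hasSum _ (fun n _ ↦ by positivity) hs
      _ ≤ 1 / 139 := by
          rw [← div_eq_mul_inv, div_le_iff₀ (by linarith)]
          linarith
  have h3 : Real.exp (1 / 139) ≤ 1 / (1 - 1 / 139) :=
    Real.exp_bound_div_one_sub_of_interval (by norm_num) (by norm_num)
  have h4 := Real.exp_le_exp.mpr h2
  norm_num at h3 ⊢
  linarith

lemma norm_discriminant_bounds {τ : ℍ} (h : ‖𝕢 1 τ‖ ≤ 1 / 140) :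
    4 / 5 * ‖𝕢 1 τ‖ ≤ ‖discriminant τ‖ ∧ ‖discriminant τ‖ ≤ 5 / 4 * ‖𝕢 1 τ‖ := by
  obtain ⟨P, hP, hD⟩ := norm_discriminant_sub_le h
  have h1 : ‖P‖ ≤ 139 / 138 := by
    have := norm_le_norm_add_norm_sub' P 1
    rw [norm_one] at this
    linarith
  have h2 : 137 / 138 ≤ ‖P‖ := by
    have := norm_sub_norm_le (1 : ℂ) P
    rw [norm_one, norm_sub_rev] at this
    linarith
  have h3 : ‖P‖ ^ 24 ≤ 5 / 4 := (pow_le_pow_left₀ (norm_nonneg P) h1 24).trans (by norm_num)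
  have h4 : 4 / 5 ≤ ‖P‖ ^ 24 := le_trans (by norm_num) (pow_le_pow_left₀ (by norm_num) h2 24)
  rw [hD, norm_mul, norm_pow]
  constructor <;> nlinarith [norm_nonneg (𝕢 1 τ)]

/-- If `z` lies at least twice as high as `τ`, then `|j(τ)| < |j(z)|`. -/
lemma norm_klein_lt {τ z : ℂ} (hτ : 4 / 5 < τ.im) (hz : 2 * τ.im ≤ z.im) :
    ‖klein τ‖ < ‖klein z‖ := by
  lift τ to ℍ using by linarith
  lift z to ℍ using by linarith
  rw [klein_eq, klein_eq, norm_div, norm_div, norm_pow, norm_pow]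
  have hnτ : ‖𝕢 1 τ‖ = Real.exp (-2 * Real.pi * (τ : ℂ).im) := by
    rw [Function.Periodic.norm_qParam, div_one]
  have hnz : ‖𝕢 1 z‖ = Real.exp (-2 * Real.pi * (z : ℂ).im) := by
    rw [Function.Periodic.norm_qParam, div_one]
  have hr : ‖𝕢 1 τ‖ ≤ 1 / 140 := by
    have h5 : Real.exp (-2 * Real.pi * (τ : ℂ).im) ≤ Real.exp (-5) :=
      Real.exp_le_exp.mpr (by nlinarith [Real.pi_gt_d2])
    rw [hnτ]
    refine h5.trans ?_
    rw [Real.exp_neg, ← one_div]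
    refine one_div_le_one_div_of_le (by norm_num) ?_
    have : Real.exp 5 = Real.exp 1 ^ 5 := by rw [← Real.exp_nat_mul]; norm_num
    rw [this]
    exact le_trans (by norm_num) (pow_le_pow_left₀ (by norm_num) Real.exp_one_gt_d9.le 5)
  have hrz : ‖𝕢 1 z‖ ≤ ‖𝕢 1 τ‖ ^ 2 := by
    rw [hnτ, hnz, ← Real.exp_nat_mul]
    exact Real.exp_le_exp.mpr (by push_cast; nlinarith [Real.pi_pos])
  have hτ0 : 0 < ‖𝕢 1 τ‖ := hnτ ▸ Real.exp_pos _
  have hz0 : 0 < ‖𝕢 1 z‖ := hnz ▸ Real.exp_pos _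
  have hrz' : ‖𝕢 1 z‖ ≤ 1 / 19600 := hrz.trans (by nlinarith)
  have hE := norm_E₄_sub_one_le hr
  have hEz := norm_E₄_sub_one_le (hrz'.trans (by norm_num))
  have hD := (norm_discriminant_bounds hr).1
  have hDz := (norm_discriminant_bounds (hrz'.trans (by norm_num))).2
  have h1 : ‖E₄ τ‖ ≤ 3 := by
    have := norm_le_norm_add_norm_sub' (E₄ τ) 1
    rw [norm_one] at this
    linarith
  have h2 : 49 / 50 ≤ ‖E₄ z‖ := by
    have := norm_sub_norm_le (1 : ℂ) (E₄ z)
    rw [norm_one, norm_sub_rev] at this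
    linarith
  have hDz0 : 0 < ‖discriminant z‖ := norm_pos_iff.mpr (discriminant_ne_zero z)
  set r := ‖𝕢 1 τ‖
  calc ‖E₄ τ‖ ^ 3 / ‖discriminant τ‖ ≤ 3 ^ 3 / (4 / 5 * r) := by gcongr
    _ < (49 / 50) ^ 3 / (5 / 4 * r ^ 2) := by
        rw [div_lt_div_iff₀ (by positivity) (by positivity)]
        nlinarith
    _ ≤ ‖E₄ z‖ ^ 3 / ‖discriminant z‖ := by
        gcongr
        exact hDz.trans (by gcongr)

/-- A singular modulus other than the dominant one is smaller than it in absolute value. -/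
lemma IsFormRoot.norm_klein_lt_of_ne {b c : ℤ} {z : ℂ} (hz : IsFormRoot 1 b c z) {u : ℂ}
    (hu : IsSingularModulus u (b ^ 2 - 4 * 1 * c)) (hne : u ≠ klein z) : ‖u‖ < ‖klein z‖ := by
  obtain ⟨τ₀, a₀, b₀, c₀, h₀, hD₀, rfl⟩ := isSingularModulus_iff.mp hu
  obtain ⟨a, b', c', τ, h, hD, hk, hb, hac⟩ := h₀.exists_reduced
  rw [← hk] at hne ⊢
  rw [← hD₀] at hD
  have hpos := h.pos
  have him : 2 * z.im = 2 * a * τ.im := by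
    rw [h.two_mul_im, show (4 * a * c' - b' ^ 2 : ℝ) = 4 * (1 : ℤ) * c - b ^ 2 by
      have : 4 * a * c' - b' ^ 2 = 4 * 1 * c - b ^ 2 := by linarith
      exact_mod_cast this, ← hz.two_mul_im]
    push_cast
    ring
  have hτ := h.im_pos
  obtain rfl | ha : 1 = a ∨ 2 ≤ a := by omega
  · refine absurd ?_ hne
    obtain ⟨k, hk⟩ : (2 : ℤ) ∣ b - b' := by
      rw [← even_iff_two_dvd, Int.even_sub, ← Int.even_pow' two_ne_zero,
        ← Int.even_pow' (m := b') two_ne_zero, ← Int.even_sub]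
      exact ⟨2 * (c - c'), by linarith⟩
    have hzre := hz.two_mul_re
    have hτre := h.two_mul_re
    have hk' : (b : ℝ) - b' = 2 * k := by exact_mod_cast hk
    have : τ = ((1 : ℤ) * z + (k : ℤ)) / ((0 : ℤ) * z + (1 : ℤ)) := by
      push_cast at him hzre hτre ⊢
      apply Complex.ext
      · simp
        linarith
      · simp
        linarith
    rw [this]
    exact _root_.klein_moebius (by norm_num) hz.im_pos
  · have ha' : (2 : ℝ) ≤ a := by exact_mod_cast ha
    refine norm_klein_lt ?_ (by nlinarith)
    have h1 := h.sq_im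
    have h2 : (3 * a * c' : ℝ) ≤ 4 * a * c' - b' ^ 2 := by
      exact_mod_cast IsFormRoot.three_mul_sq_le hpos hb hac
    have h3 : (a : ℝ) ≤ c' := by exact_mod_cast hac
    have h4 : 3 ≤ 4 * τ.im ^ 2 := by
      refine le_of_mul_le_mul_left ?_ (show (0 : ℝ) < a ^ 2 by positivity)
      have := mul_le_mul_of_nonneg_left h3 (show (0 : ℝ) ≤ a by linarith)
      linear_combination 3 * this + h2 - h1
    nlinarith

/-- Conjugate singular moduli of degree two have distinct absolute values. -/
lemma norm_ne_of_add_of_mul {x y : ℂ} {s t : ℚ} (hs : x + y = s) (ht : x * y = t) {D : ℤ}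
    (hx : IsSingularModulus x D) (hy : IsSingularModulus y D) (hxy : x ≠ y) : ‖x‖ ≠ ‖y‖ := by
  obtain ⟨b, c, z, hz, rfl, rfl | rfl⟩ := exists_dominant hs ht hx
  · exact (hz.norm_klein_lt_of_ne hy hxy.symm).ne'
  · exact (hz.norm_klein_lt_of_ne hx hxy).ne

/-- The sum and the product of two distinct conjugate quadratic numbers are rational. -/
lemma exists_add_eq_and_mul_eq {x y : ℂ} (hxy : x ≠ y) (hdx : (minpoly ℚ x).natDegree = 2)
    (hconj : minpoly ℚ x = minpoly ℚ y) :
    ∃ s t : ℚ, x + y = s ∧ x * y = t := by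
  have hint : IsIntegral ℚ x := by
    by_contra h
    simp [minpoly.eq_zero h] at hdx
  set f := minpoly ℚ x with hf
  have hmon : f.Monic := minpoly.monic hint
  have h2 : f.coeff 2 = 1 := hdx ▸ hmon.coeff_natDegree
  have key : ∀ w : ℂ, Polynomial.aeval w f = w ^ 2 + f.coeff 1 * w + f.coeff 0 := by
    intro w
    rw [Polynomial.aeval_eq_sum_range, hdx]
    simp [Finset.sum_range_succ, h2, Algebra.smul_def]
    ring
  have hx := minpoly.aeval ℚ x
  have hy := minpoly.aeval ℚ y
  rw [← hf, key] at hx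
  rw [← hconj, key] at hy
  have hs : x + y = -f.coeff 1 := by
    apply mul_left_cancel₀ (sub_ne_zero.mpr hxy)
    linear_combination hx - hy
  refine ⟨-f.coeff 1, f.coeff 0, by push_cast; exact hs, ?_⟩
  linear_combination x * hs - hx

lemma zpow_mul_zpow_swap {x y : ℂ} {s : ℚ} (hs : x + y = s) (hint : IsIntegral ℚ x)
    (hconj : minpoly ℚ x = minpoly ℚ y) {m n : ℤ} {A : ℚ} (h : x ^ m * y ^ n = A) :
    y ^ m * x ^ n = A := by
  let K := IntermediateField.adjoin ℚ {x}
  let g : K := IntermediateField.AdjoinSimple.gen ℚ x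
  let φ : K →ₐ[ℚ] ℂ := (IntermediateField.adjoin.powerBasis hint).lift y (by
    rw [IntermediateField.adjoin.powerBasis_gen, IntermediateField.minpoly_gen, hconj]
    exact minpoly.aeval ℚ y)
  have hg : (g : ℂ) = x := IntermediateField.AdjoinSimple.coe_gen ℚ x
  have hφ : φ g = y := (IntermediateField.adjoin.powerBasis hint).lift_gen y _
  have hy : y = ((s - g : K) : ℂ) := by
    push_cast
    rw [hg]
    linear_combination hs
  have hA : g ^ m * (s - g) ^ n = (A : K) := by
    apply Subtype.val_injective
    rw [hy, ← hg] at h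
    change ((g : ℂ) ^ m * ((s - g : K) : ℂ) ^ n) = ((A : K) : ℂ)
    simpa using h
  have := congrArg φ hA
  simp only [map_mul, map_zpow₀, map_sub, map_ratCast, hφ] at this
  rw [← this, ← hs]
  simp

end

theorem conjugate_quadratic_singular_moduli_product_rational
    (x y : ℂ) (Δ : ℤ) (hx : IsSingularModulus x Δ) (hy : IsSingularModulus y Δ)
    (hxy : x ≠ y)
    (hdx : (minpoly ℚ x).natDegree = 2) (hdy : (minpoly ℚ y).natDegree = 2)
    (hconj : minpoly ℚ x = minpoly ℚ y)
    (m n : ℤ) (hm : m ≠ 0) (hn : n ≠ 0)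
    (A : ℚ) (hA : A ≠ 0) (h : x ^ m * y ^ n = (A : ℂ)) :
    m = n := by
  obtain ⟨s, t, hs, ht⟩ := exists_add_eq_and_mul_eq hxy hdx hconj
  have hint : IsIntegral ℚ x := by
    by_contra h
    simp [minpoly.eq_zero h] at hdx
  have h' := zpow_mul_zpow_swap hs hint hconj h
  have hA' : x ^ m * y ^ n ≠ 0 := by rw [h]; exact_mod_cast hA
  have hx0 : x ≠ 0 := by rintro rfl; simp [zero_zpow _ hm] at hA'
  have hy0 : y ≠ 0 := by rintro rfl; simp [zero_zpow _ hn] at hA'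
  have hpow : x ^ (m - n) = y ^ (m - n) := by
    rw [zpow_sub₀ hx0, zpow_sub₀ hy0, div_eq_div_iff (zpow_ne_zero _ hx0) (zpow_ne_zero _ hy0),
      h, h']
  by_contra hmn
  refine norm_ne_of_add_of_mul hs ht hx hy hxy ?_
  have := congrArg norm hpow
  rw [norm_zpow, norm_zpow] at this
  exact (zpow_left_inj₀ (norm_nonneg x) (norm_nonneg y) (sub_ne_zero.mpr hmn)).mp this
end

section
/- For all real numbers s > 1 and A > 1, if s·log s < A then s < (1 + 1/e)·A/log A. -/
theorem lt_of_mul_log_lt (s A : ℝ) (hs : 1 < s) (hA : 1 < A)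
    (h : s * Real.log s < A) :
    s < (1 + 1 / Real.exp 1) * A / Real.log A := by
  have hs0 : 0 < s := by linarith
  have ht : 0 < A / s := by positivity
  have log_s_lt : Real.log s < A / s := by rwa [lt_div_iff₀' hs0]
  have log_div_le : Real.log (A / s) ≤ A / s / Real.exp 1 := by
    have key := Real.log_le_sub_one_of_pos (div_pos ht (Real.exp_pos 1))
    rw [Real.log_div ht.ne' (Real.exp_pos 1).ne', Real.log_exp] at key
    linarith
  rw [Real.log_div (by positivity) hs0.ne'] at log_div_le
  rw [lt_div_iff₀ (Real.log_pos hA)]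
  calc s * Real.log A < s * (A / s + A / s / Real.exp 1) := by
        gcongr
        linarith
    _ = (1 + 1 / Real.exp 1) * A := by field_simp
end
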